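/- arXiv:2207.01721 — 7 statements merged into one kernel-verified Lean document; each statement's English description precedes it below -/
import Mathlib

section
/- For every signal parameter γ ∈ (0, 1], there exist a routing problem G whose latency functions are affine (of the form ℓ_e(y) = a_e·y + b_e with a_e, b_e ≥ 0), a sensitivity distribution β, a Nash flow f_γ of (G, β, γ), and a Nash flow f_0 of (G, β, 0) such that L(f_γ) > L(f_0). Consequently, for the class 𝒢 of all routing problems, the perversity index PI(𝒢, γ) := sup_{G} sup_{β} (worst Nash total latency of (G,β,γ)) / (Nash total latency of (G,β,0)) is strictly greater than 1 for every γ ∈ (0,1]. -/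
open MeasureTheory

/-- A nonatomic routing problem: finite edge set, finite commodity set, traffic
rates, finite nonempty path sets, and nondecreasing convex continuously
differentiable nonnegative latency functions. -/
structure RoutingProblem where
  E : Type
  instFintypeE : Fintype E
  instDecEqE : DecidableEq E
  C : Type
  instFintypeC : Fintype C
  r : C → ℝ
  r_pos : ∀ c, 0 < r c
  paths : C → Finset (Finset E)
  paths_nonempty : ∀ c, (paths c).Nonempty
  lat : E → ℝ → ℝ
  lat_nonneg : ∀ e y, 0 ≤ y → 0 ≤ lat e y
  lat_mono : ∀ e, MonotoneOn (lat e) (Set.Ici 0)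
  lat_convex : ∀ e, ConvexOn ℝ (Set.Ici 0) (lat e)
  lat_smooth : ∀ e, ContDiffOn ℝ 1 (lat e) (Set.Ici 0)

attribute [instance] RoutingProblem.instFintypeE RoutingProblem.instDecEqE
  RoutingProblem.instFintypeC

namespace RoutingProblem

variable (G : RoutingProblem)

/-- `σ` is a valid assignment of users `[0, r c]` to paths of their commodity,
measurable in the sense that each preimage of a path is measurable. -/
def IsAssignment (σ : G.C → ℝ → Finset G.E) : Prop :=
  (∀ c x, x ∈ Set.Icc 0 (G.r c) → σ c x ∈ G.paths c) ∧
  (∀ c (p : Finset G.E), MeasurableSet {x : ℝ | σ c x = p})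

/-- The edge flow induced by an assignment. -/
noncomputable def edgeFlow (σ : G.C → ℝ → Finset G.E) (e : G.E) : ℝ :=
  ∑ c, (volume {x : ℝ | x ∈ Set.Icc 0 (G.r c) ∧ e ∈ σ c x}).toReal

/-- The path flow induced by an assignment. -/
noncomputable def pathFlow (σ : G.C → ℝ → Finset G.E) (p : Finset G.E) : ℝ :=
  ∑ c, (volume {x : ℝ | x ∈ Set.Icc 0 (G.r c) ∧ σ c x = p}).toReal

/-- Total latency of an edge-flow vector. -/
noncomputable def totalLatency (f : G.E → ℝ) : ℝ :=
  ∑ e, f e * G.lat e (f e)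

/-- `β` is a sensitivity distribution: for each commodity a nondecreasing
measurable function into `[0,1]`. -/
def IsSensitivity (β : G.C → ℝ → ℝ) : Prop :=
  ∀ c, MonotoneOn (β c) (Set.Icc 0 (G.r c)) ∧ Measurable (β c) ∧
    ∀ x ∈ Set.Icc 0 (G.r c), β c x ∈ Set.Icc (0:ℝ) 1

/-- Slowdown-sensitivity cost of path `p` under edge flow `f` for user `x` of
commodity `c`, given signal `γ`. -/
noncomputable def cost (β : G.C → ℝ → ℝ) (γ : ℝ) (c : G.C) (x : ℝ)
    (p : Finset G.E) (f : G.E → ℝ) : ℝ :=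
  ∑ e ∈ p, (G.lat e (f e) - γ * β c x * G.lat e 0)

/-- Nash flow for a general family of user cost functions `K c x p f`. -/
def IsNashFor (K : G.C → ℝ → Finset G.E → (G.E → ℝ) → ℝ)
    (σ : G.C → ℝ → Finset G.E) : Prop :=
  G.IsAssignment σ ∧
  ∀ c, ∀ᵐ x ∂(volume.restrict (Set.Icc 0 (G.r c))),
    ∀ p ∈ G.paths c, K c x (σ c x) (G.edgeFlow σ) ≤ K c x p (G.edgeFlow σ)

/-- Nash flow of the slowdown-sensitivity game `(G, β, γ)`. -/
def IsNashFlow (β : G.C → ℝ → ℝ) (γ : ℝ) (σ : G.C → ℝ → Finset G.E) : Prop :=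
  G.IsNashFor (G.cost β γ) σ

/-- All latency functions are polynomials `a_e y^d + b_e` with `a_e, b_e ≥ 0`. -/
def IsPolyDeg (d : ℕ) : Prop :=
  ∀ e, ∃ a b : ℝ, 0 ≤ a ∧ 0 ≤ b ∧ ∀ y : ℝ, G.lat e y = a * y ^ d + b

/-- Parallel network: each path is a single edge and distinct paths are disjoint. -/
def IsParallel : Prop :=
  (∀ c, ∀ p ∈ G.paths c, p.card = 1) ∧
  (∀ c c', ∀ p ∈ G.paths c, ∀ p' ∈ G.paths c', p ≠ p' → Disjoint p p')

/-- A feasible (fractional) path-flow vector. -/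
def IsFeasible (g : G.C → Finset G.E → ℝ) : Prop :=
  (∀ c p, 0 ≤ g c p) ∧ (∀ c p, p ∉ G.paths c → g c p = 0) ∧
  (∀ c, ∑ p ∈ G.paths c, g c p = G.r c)

/-- Edge flow induced by a fractional path-flow vector. -/
noncomputable def flowOf (g : G.C → Finset G.E → ℝ) (e : G.E) : ℝ :=
  ∑ c, ∑ p ∈ G.paths c, if e ∈ p then g c p else 0

/-- Minimum total latency over feasible flows. -/
noncomputable def optLatency : ℝ :=
  sInf {L : ℝ | ∃ g, G.IsFeasible g ∧ L = G.totalLatency (G.flowOf g)}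

/-- The Rosenthal-type potential of the slowdown-sensitivity game. -/
noncomputable def potential (β : G.C → ℝ → ℝ) (γ : ℝ)
    (σ : G.C → ℝ → Finset G.E) : ℝ :=
  (∑ e, ∫ t in (0:ℝ)..(G.edgeFlow σ e), G.lat e t) -
    γ * ∑ c, ∫ x in Set.Icc (0:ℝ) (G.r c), β c x * ∑ e ∈ σ c x, G.lat e 0

end RoutingProblem

noncomputable def psLat (e : Fin 3) (y : ℝ) : ℝ := y + (![2, 3, 0] : Fin 3 → ℝ) e

noncomputable def psG : RoutingProblem where
  E := Fin 3
  instFintypeE := inferInstance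
  instDecEqE := inferInstance
  C := Fin 2
  instFintypeC := inferInstance
  r := ![2, 5]
  r_pos := by intro c; fin_cases c <;> norm_num
  paths := ![{{0}, {1}}, {{1}, {2}}]
  paths_nonempty := by intro c; fin_cases c <;> simp
  lat := psLat
  lat_nonneg := by
    intro e y hy; fin_cases e <;> simp [psLat] <;> linarith
  lat_mono := by
    intro e x _ y _ h; simpa [psLat] using h
  lat_convex := by
    intro e
    exact (convexOn_id (convex_Ici 0)).add_const _
  lat_smooth := by
    intro e
    unfold psLat
    fun_prop

/-- the threshold assignment -/
noncomputable def psS (t : ℝ) : Fin 2 → ℝ → Finset (Fin 3) :=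
  ![fun x => if x ≤ 2 - t then {0} else {1}, fun x => if x ≤ 4 + t / 2 then {2} else {1}]

noncomputable def psB : Fin 2 → ℝ → ℝ := ![fun _ => 1, fun _ => 0]

lemma psFlow (t : ℝ) (h0 : 0 ≤ t) (h1 : t ≤ 1) :
    psG.edgeFlow (psS t) = (![2 - t, 1 + t / 2, 4 + t / 2] : Fin 3 → ℝ) := by
  have A0 : {x : ℝ | x ∈ Set.Icc (0:ℝ) 2 ∧ (0 : Fin 3) ∈ psS t 0 x} = Set.Icc 0 (2 - t) := by
    ext x
    by_cases h : x ≤ 2 - t <;> simp [psS, h]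
    intro _; linarith
  have A1 : {x : ℝ | x ∈ Set.Icc (0:ℝ) 2 ∧ (1 : Fin 3) ∈ psS t 0 x} = Set.Ioc (2 - t) 2 := by
    ext x
    by_cases h : x ≤ 2 - t
    · simp [psS, h, not_lt.2 h]
    · have := not_le.1 h
      simp [psS, h, this]
      intro _; linarith
  have A2 : {x : ℝ | x ∈ Set.Icc (0:ℝ) 2 ∧ (2 : Fin 3) ∈ psS t 0 x} = ∅ := by
    ext x
    by_cases h : x ≤ 2 - t <;> simp [psS, h]
  have B0 : {x : ℝ | x ∈ Set.Icc (0:ℝ) 5 ∧ (0 : Fin 3) ∈ psS t 1 x} = ∅ := by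
    ext x
    by_cases h : x ≤ 4 + t / 2 <;> simp [psS, h]
  have B1 : {x : ℝ | x ∈ Set.Icc (0:ℝ) 5 ∧ (1 : Fin 3) ∈ psS t 1 x} = Set.Ioc (4 + t / 2) 5 := by
    ext x
    by_cases h : x ≤ 4 + t / 2
    · simp [psS, h, not_lt.2 h]
    · have := not_le.1 h
      simp [psS, h, this]
      intro _; linarith
  have B2 : {x : ℝ | x ∈ Set.Icc (0:ℝ) 5 ∧ (2 : Fin 3) ∈ psS t 1 x} = Set.Icc 0 (4 + t / 2) := by
    ext x
    by_cases h : x ≤ 4 + t / 2 <;> simp [psS, h]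
    intro _; linarith
  have key : ∀ e : Fin 3, psG.edgeFlow (psS t) e =
      (volume {x : ℝ | x ∈ Set.Icc (0:ℝ) 2 ∧ e ∈ psS t 0 x}).toReal +
      (volume {x : ℝ | x ∈ Set.Icc (0:ℝ) 5 ∧ e ∈ psS t 1 x}).toReal :=
    fun e => Fin.sum_univ_two (fun c : Fin 2 =>
      (volume {x : ℝ | x ∈ Set.Icc (0:ℝ) ((![2, 5] : Fin 2 → ℝ) c) ∧ e ∈ psS t c x}).toReal)
  have e0 : psG.edgeFlow (psS t) (0 : Fin 3) = 2 - t := by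
    rw [key, A0, B0, Real.volume_Icc, ENNReal.toReal_ofReal (by linarith)]; simp
  have e1 : psG.edgeFlow (psS t) (1 : Fin 3) = 1 + t / 2 := by
    rw [key, A1, B1, Real.volume_Ioc, Real.volume_Ioc, ENNReal.toReal_ofReal (by linarith),
      ENNReal.toReal_ofReal (by linarith)]; ring
  have e2 : psG.edgeFlow (psS t) (2 : Fin 3) = 4 + t / 2 := by
    rw [key, A2, B2, Real.volume_Icc, ENNReal.toReal_ofReal (by linarith)]; simp
  funext e
  change Fin 3 at e
  fin_cases e
  · exact e0
  · exact e1
  · exact e2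

lemma psAssign (t : ℝ) : psG.IsAssignment (psS t) := by
  constructor
  · intro c x _
    change Fin 2 at c
    change psS t c x ∈ (![{{0}, {1}}, {{1}, {2}}] : Fin 2 → Finset (Finset (Fin 3))) c
    fin_cases c
    · by_cases h : x ≤ 2 - t <;> simp [psS, h]
    · by_cases h : x ≤ 4 + t / 2 <;> simp [psS, h]
  · intro c p
    change Fin 2 at c
    change Finset (Fin 3) at p
    change MeasurableSet (psS t c ⁻¹' {p})
    let _ : MeasurableSpace (Finset (Fin 3)) := ⊤
    have : Measurable (psS t c) := by
      fin_cases c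
      · exact Measurable.ite measurableSet_Iic measurable_const measurable_const
      · exact Measurable.ite measurableSet_Iic measurable_const measurable_const
    exact this trivial

lemma psCost (γ : ℝ) (c : Fin 2) (x : ℝ) (e : Fin 3) (f : Fin 3 → ℝ) :
    psG.cost psB γ c x ({e} : Finset (Fin 3)) f = psLat e (f e) - γ * psB c x * psLat e 0 :=
  Finset.sum_singleton (fun e : Fin 3 => psLat e (f e) - γ * psB c x * psLat e 0) e

lemma psNash (γ t : ℝ) (h0 : 0 ≤ t) (h1 : t ≤ 1) (h : 3 * t = 2 * γ) :
    psG.IsNashFlow psB γ (psS t) := by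
  refine ⟨psAssign t, ?_⟩
  intro c
  rw [psFlow t h0 h1]
  filter_upwards [ae_restrict_mem measurableSet_Icc] with x hx p hp
  have hs := (psAssign t).1 c x hx
  revert hs
  generalize psS t c x = q
  intro hs
  change Fin 2 at c
  change Finset (Fin 3) at p q
  change p ∈ (![{{0}, {1}}, {{1}, {2}}] : Fin 2 → Finset (Finset (Fin 3))) c at hp
  change q ∈ (![{{0}, {1}}, {{1}, {2}}] : Fin 2 → Finset (Finset (Fin 3))) c at hs
  clear hx
  fin_cases c <;> simp at hp hs <;> rcases hp with rfl | rfl <;> rcases hs with rfl | rfl <;>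
    first | exact le_rfl | (rw [psCost, psCost]; simp [psLat, psB] <;> linarith)

lemma psTotal (t : ℝ) (h0 : 0 ≤ t) (h1 : t ≤ 1) :
    psG.totalLatency (psG.edgeFlow (psS t)) = 28 + t / 2 + 3 / 2 * t ^ 2 := by
  rw [psFlow t h0 h1]
  refine (Fin.sum_univ_three (fun e : Fin 3 =>
    (![2 - t, 1 + t / 2, 4 + t / 2] : Fin 3 → ℝ) e *
      psLat e ((![2 - t, 1 + t / 2, 4 + t / 2] : Fin 3 → ℝ) e))).trans ?_
  simp [psLat]
  ring

/-- for every `γ ∈ (0,1]` there is an affine-latency routing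
problem, a sensitivity distribution, and Nash flows of `(G,β,γ)` and `(G,β,0)`
such that signaling strictly increases total latency; hence `PI(𝒢,γ) > 1`. -/
theorem perverse_signal_exists (γ : ℝ) (hγ : γ ∈ Set.Ioc (0:ℝ) 1) :
    ∃ G : RoutingProblem, G.IsPolyDeg 1 ∧
      ∃ β : G.C → ℝ → ℝ, G.IsSensitivity β ∧
        ∃ σγ σ0 : G.C → ℝ → Finset G.E,
          G.IsNashFlow β γ σγ ∧ G.IsNashFlow β 0 σ0 ∧
            G.totalLatency (G.edgeFlow σ0) < G.totalLatency (G.edgeFlow σγ) := by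
  obtain ⟨hg0, hg1⟩ := hγ
  refine ⟨psG, ?_, psB, ?_, psS (2 * γ / 3), psS 0, psNash _ _ (by linarith) (by linarith) (by ring),
    psNash _ _ le_rfl zero_le_one (by ring), ?_⟩
  · intro e
    change Fin 3 at e
    refine ⟨1, (![2, 3, 0] : Fin 3 → ℝ) e, zero_le_one, ?_, ?_⟩
    · fin_cases e <;> simp
    · intro y
      change y + (![2, 3, 0] : Fin 3 → ℝ) e = _
      ring
  · intro c
    change Fin 2 at c
    refine ⟨?_, ?_, ?_⟩
    · fin_cases c
      · exact monotoneOn_const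
      · exact monotoneOn_const
    · fin_cases c
      · exact measurable_const
      · exact measurable_const
    · intro x _
      fin_cases c <;> simp [psB]
  · rw [psTotal _ le_rfl zero_le_one, psTotal _ (by linarith) (by linarith)]
    nlinarith [sq_nonneg (2 * γ / 3)]
end

section
/- Fix an integer d ≥ 1 and let γ ∈ (d/(d+1), 1]. Then there exist a parallel routing problem G whose latency functions have the form ℓ_e(y) = a_e·y^d + b_e with constants a_e, b_e ≥ 0, a sensitivity distribution β, a Nash flow f_γ of (G, β, γ), and a Nash flow f_0 of (G, β, 0) such that L(f_γ) > L(f_0). That is, every signal γ > d/(d+1) is perverse on the class 𝒢_p^d of parallel routing problems with degree-d polynomial latencies. -/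
open MeasureTheory

/-- Pigou-type network: edge `true` has latency `y^d`, edge `false` has latency `d+1`. -/
noncomputable def pigou (d : ℕ) : RoutingProblem where
  E := Bool
  instFintypeE := inferInstance
  instDecEqE := inferInstance
  C := Unit
  instFintypeC := inferInstance
  r := fun _ => 1
  r_pos := fun _ => one_pos
  paths := fun _ => {{true}, {false}}
  paths_nonempty := fun _ => ⟨{true}, by simp⟩
  lat := fun e y => (if e = true then 1 else 0) * y ^ d + (if e = true then 0 else (d : ℝ) + 1)
  lat_nonneg := by
    intro e y hy
    split_ifs <;> positivity
  lat_mono := by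
    intro e x hx y hy hxy
    have := pow_le_pow_left₀ (Set.mem_Ici.1 hx) hxy d
    cases e <;> simp [this]
  lat_convex := by
    intro e
    cases e
    · simpa using convexOn_const ((d : ℝ) + 1) (convex_Ici (0:ℝ))
    · simpa using convexOn_pow d
  lat_smooth := by
    intro e
    fun_prop

/-- Users up to `t` take edge `true`. -/
noncomputable def cut (t : ℝ) : ℝ → Finset Bool := fun x => if x ≤ t then {true} else {false}

lemma mem_two {p : Finset Bool} (hp : p ∈ ({{true}, {false}} : Finset (Finset Bool))) :
    p = {true} ∨ p = {false} := by simpa using hp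

lemma pigou_flow (d : ℕ) (t : ℝ) (h0 : 0 ≤ t) (h1 : t ≤ 1) (e : Bool) :
    (pigou d).edgeFlow (fun _ => cut t) e = if e = true then t else 1 - t := by
  unfold RoutingProblem.edgeFlow
  change ∑ c : Unit, (volume {x : ℝ | x ∈ Set.Icc (0:ℝ) 1 ∧ e ∈ cut t x}).toReal = _
  cases e
  · have : {x : ℝ | x ∈ Set.Icc (0:ℝ) 1 ∧ false ∈ cut t x} = Set.Ioc t 1 := by
      ext x
      simp only [Set.mem_ofPred_eq, Set.mem_Icc, Set.mem_Ioc, cut]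
      split_ifs with h
      · simp; intro h'; linarith
      · simp; intro h'; constructor
        · intro _; linarith
        · intro _; linarith
    rw [this]
    simp [h1]
  · have : {x : ℝ | x ∈ Set.Icc (0:ℝ) 1 ∧ true ∈ cut t x} = Set.Icc 0 t := by
      ext x
      simp only [Set.mem_ofPred_eq, Set.mem_Icc, cut]
      split_ifs with h
      · simp [h]; intro h'; linarith
      · simp [h]
    rw [this]
    simp [h0]

lemma pigou_total (d : ℕ) (t : ℝ) (h0 : 0 ≤ t) (h1 : t ≤ 1) :
    (pigou d).totalLatency ((pigou d).edgeFlow (fun _ => cut t)) =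
      t * t ^ d + (1 - t) * (d + 1) := by
  rw [funext (pigou_flow d t h0 h1)]
  unfold RoutingProblem.totalLatency
  change ∑ e : Bool, _ = _
  simp [pigou]

lemma pigou_assign (d : ℕ) (t : ℝ) : (pigou d).IsAssignment (fun _ => cut t) := by
  constructor
  · intro c x _
    change cut t x ∈ ({{true}, {false}} : Finset (Finset Bool))
    unfold cut
    split_ifs <;> simp
  · intro c p
    change MeasurableSet {x : ℝ | cut t x = p}
    have : Measurable[_, ⊤] (cut t) := by
      unfold cut
      exact Measurable.ite (measurableSet_Iic) (@measurable_const _ _ ⊤ _ _) (@measurable_const _ _ ⊤ _ _)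
    exact this (t := {p}) trivial

lemma pigou_cost (d : ℕ) (hd : 1 ≤ d) (γ t x : ℝ) (c : (pigou d).C) (h0 : 0 ≤ t) (h1 : t ≤ 1)
    (e : Bool) :
    (pigou d).cost (fun _ _ => 1) γ c x ({e} : Finset Bool)
      ((pigou d).edgeFlow (fun _ => cut t)) =
      if e = true then t ^ d else (1 - γ) * (d + 1) := by
  rw [funext (pigou_flow d t h0 h1)]
  unfold RoutingProblem.cost
  have hd' : d ≠ 0 := by omega
  refine (Finset.sum_singleton _ _).trans ?_
  cases e
  · simp [pigou]; ring
  · simp [pigou, hd']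

/-- every signal `γ ∈ (d/(d+1), 1]` is perverse on the class of
parallel routing problems with degree-`d` polynomial latencies. -/
theorem perverse_on_parallel_above_threshold (d : ℕ) (hd : 1 ≤ d) (γ : ℝ)
    (hγ : γ ∈ Set.Ioc ((d : ℝ) / ((d : ℝ) + 1)) 1) :
    ∃ G : RoutingProblem, G.IsParallel ∧ G.IsPolyDeg d ∧
      ∃ β : G.C → ℝ → ℝ, G.IsSensitivity β ∧
        ∃ σγ σ0 : G.C → ℝ → Finset G.E,
          G.IsNashFlow β γ σγ ∧ G.IsNashFlow β 0 σ0 ∧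
            G.totalLatency (G.edgeFlow σ0) < G.totalLatency (G.edgeFlow σγ) := by
  obtain ⟨hγ1, hγ2⟩ := hγ
  have hd' : d ≠ 0 := by omega
  have hs0 : 0 ≤ (1 - γ) * ((d:ℝ) + 1) := mul_nonneg (by linarith) (by positivity)
  have hs1 : (1 - γ) * ((d:ℝ) + 1) < 1 := by
    rw [div_lt_iff₀ (by positivity)] at hγ1
    linarith
  obtain ⟨t, ht0, ht⟩ : ∃ t : ℝ, 0 ≤ t ∧ t ^ d = (1 - γ) * ((d:ℝ) + 1) :=
    ⟨_, Real.rpow_nonneg hs0 (d:ℝ)⁻¹, Real.rpow_inv_natCast_pow hs0 hd'⟩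
  have ht1 : t < 1 := by
    by_contra h
    have := one_le_pow₀ (n := d) (not_lt.1 h)
    linarith
  refine ⟨pigou d, ⟨?_, ?_⟩, ?_, fun _ _ => 1, ?_, fun _ => cut t, fun _ => cut 1,
    ⟨pigou_assign d t, ?_⟩, ⟨pigou_assign d 1, ?_⟩, ?_⟩
  · intro c p hp
    change p ∈ ({{true}, {false}} : Finset (Finset Bool)) at hp
    replace hp := mem_two hp
    rcases hp with rfl | rfl <;> rfl
  · intro c c' p hp p' hp' hne
    change p ∈ ({{true}, {false}} : Finset (Finset Bool)) at hp
    change p' ∈ ({{true}, {false}} : Finset (Finset Bool)) at hp'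
    replace hp := mem_two hp
    replace hp' := mem_two hp'
    rcases hp with rfl | rfl <;> rcases hp' with rfl | rfl
    · exact absurd rfl hne
    · exact Finset.disjoint_singleton.2 (by decide)
    · exact Finset.disjoint_singleton.2 (by decide)
    · exact absurd rfl hne
  · intro e
    refine ⟨_, _, ?_, ?_, fun y => rfl⟩
    · split_ifs <;> norm_num
    · split_ifs <;> positivity
  · intro c
    exact ⟨monotoneOn_const, measurable_const, fun x _ => ⟨zero_le_one, le_rfl⟩⟩
  · intro c
    refine Filter.Eventually.of_forall fun x p hp => ?_
    change p ∈ ({{true}, {false}} : Finset (Finset Bool)) at hp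
    have key : ∀ e : Bool, (pigou d).cost (fun _ _ => 1) γ c x ({e} : Finset Bool)
      ((pigou d).edgeFlow (fun _ => cut t)) = t ^ d := by
      intro e
      rw [pigou_cost d hd γ t x c ht0 ht1.le e, ← ht, ite_self]
    have h2 : ∀ q : Finset Bool, q ∈ ({{true}, {false}} : Finset (Finset Bool)) →
        (pigou d).cost (fun _ _ => 1) γ c x q
          ((pigou d).edgeFlow (fun _ => cut t)) = t ^ d := by
      intro q hq
      simp only [Finset.mem_insert, Finset.mem_singleton] at hq
      rcases hq with rfl | rfl
      · exact key true
      · exact key false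
    refine ((h2 (cut t x) ?_).trans (h2 p hp).symm).le
    unfold cut
    split_ifs <;> simp
  · intro c
    refine (ae_restrict_iff' measurableSet_Icc).2 (Filter.Eventually.of_forall fun x hx p hp => ?_)
    change p ∈ ({{true}, {false}} : Finset (Finset Bool)) at hp
    change x ∈ Set.Icc (0:ℝ) 1 at hx
    have hc : cut 1 x = {true} := if_pos hx.2
    change (pigou d).cost (fun _ _ => 1) 0 c x (cut 1 x) _ ≤ _
    rw [hc]
    replace hp := mem_two hp
    rcases hp with rfl | rfl
    · exact le_rfl
    · refine (pigou_cost d hd 0 1 x c zero_le_one le_rfl true).le.trans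
        (le_trans ?_ (pigou_cost d hd 0 1 x c zero_le_one le_rfl false).ge)
      simp
  · rw [pigou_total d t ht0 ht1.le, pigou_total d 1 zero_le_one le_rfl]
    have hb := one_add_mul_self_lt_rpow_one_add (s := t - 1) (by linarith) (by linarith)
      (p := (d:ℝ) + 1) (by have : (1:ℝ) ≤ d := by exact_mod_cast hd
                           linarith)
    have h3 : (1 + (t - 1)) ^ ((d:ℝ) + 1) = t * t ^ d := by
      rw [add_sub_cancel, ← pow_succ', ← Real.rpow_natCast]
      push_cast
      rfl
    rw [h3] at hb
    simp only [one_pow]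
    linarith
end

section
/- (Lemma 2, part 1: existence.) For every routing problem G, every sensitivity distribution β, and every γ ≥ 0, the slowdown-sensitivity game (G, β, γ) admits at least one Nash flow; that is, there exists an assignment σ such that for every commodity c and almost every user x ∈ [0, r^c], J^{c,x}(σ^c(x); f) ≤ J^{c,x}(p; f) for every p ∈ 𝒫^c, where f is the flow induced by σ. -/
open MeasureTheory

theorem nfe_enum {α : Type*} [DecidableEq α] (f : α → ℝ) (s : Finset α) :
    s = ∅ ∨ ∃ (p : ℕ → α) (N : ℕ), 0 < N ∧ (Monotone fun k => f (p k)) ∧ (∀ k, p k ∈ s) ∧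
      ∀ a ∈ s, ∃ k < N, p k = a := by
  induction s using Finset.induction_on_max_value f with
  | empty => left; rfl
  | insert a s ha hle ih =>
    right
    rcases ih with rfl | ⟨p, N, hN, hm, hp, hs⟩
    · exact ⟨fun _ => a, 1, one_pos, fun _ _ _ => le_rfl, by simp, by
        intro b hb; exact ⟨0, one_pos, by simpa [eq_comm] using hb⟩⟩
    · refine ⟨fun k => if k < N then p k else a, N + 1, by omega, ?_, ?_, ?_⟩
      · intro k l hkl
        by_cases h1 : l < N
        · have h2 : k < N := by omega
          simpa [h1, h2] using hm hkl
        · by_cases h2 : k < N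
          · simpa [h1, h2] using hle _ (hp k)
          · simp [h1, h2]
      · intro k
        by_cases h2 : k < N
        · simpa [h2] using Or.inr (hp k)
        · simp [h2]
      · intro b hb
        rcases Finset.mem_insert.1 hb with rfl | hb
        · exact ⟨N, by omega, by simp⟩
        · obtain ⟨k, hk, rfl⟩ := hs b hb
          exact ⟨k, by omega, by simp [hk]⟩

theorem nfe_prim (b : ℝ → ℝ) (hb : Monotone b) (x s u : ℝ)
    (h : (x ≤ u ∧ u ≤ s) ∨ (s ≤ u ∧ u ≤ x)) :
    (∫ t in (0:ℝ)..u, b t) - (∫ t in (0:ℝ)..s, b t) ≤ (u - s) * b x := by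
  have hi : ∀ a c : ℝ, IntervalIntegrable b volume a c := fun a c => hb.intervalIntegrable
  rw [intervalIntegral.integral_interval_sub_left (hi _ _) (hi _ _)]
  rcases h with ⟨h1, h2⟩ | ⟨h1, h2⟩
  · rw [intervalIntegral.integral_symm]
    have : ∫ t in u..s, b x ≤ ∫ t in u..s, b t :=
      intervalIntegral.integral_mono_on h2 (by simp) (hi _ _)
        (fun t ht => hb (h1.trans ht.1))
    simp at this
    linarith
  · have : ∫ t in s..u, b t ≤ ∫ t in s..u, b x :=
      intervalIntegral.integral_mono_on h1 (hi _ _) (by simp)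
        (fun t ht => hb (ht.2.trans h2))
    simpa using this

def nfeδ (i j k : ℕ) : ℝ := (if j < k then 1 else 0) - (if i < k then 1 else 0)

theorem nfeδ_succ (i j k : ℕ) : nfeδ i j (k+1) - nfeδ i j k =
    (if k = j then 1 else 0) - (if k = i then 1 else 0) := by
  unfold nfeδ
  have h : ∀ j : ℕ, (if j < k + 1 then (1:ℝ) else 0) - (if j < k then 1 else 0)
      = if k = j then 1 else 0 := by
    intro j
    split_ifs <;> first | omega | norm_num
  linarith [h i, h j]

theorem nfe_sum1 (a : ℕ → ℝ) (N i j : ℕ) (hi : i < N) (hj : j < N) :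
    ∑ k ∈ Finset.range N, a k * (nfeδ i j (k+1) - nfeδ i j k) = a j - a i := by
  simp only [nfeδ_succ, mul_sub, Finset.sum_sub_distrib, mul_ite, mul_one, mul_zero,
    Finset.sum_ite_eq', Finset.mem_range, hi, hj, if_true]

theorem nfe_sum2 (w : ℕ → ℝ) (N i j : ℕ) (hi : i < N) (hj : j < N) :
    ∑ k ∈ Finset.range N, (w (k+1) - w k) * nfeδ i j (k+1) = w i - w j := by
  have h := nfe_sum1 w N i j hi hj
  have h2 := Finset.sum_range_sub (fun k => w k * nfeδ i j k) N
  have h3 : nfeδ i j N = 0 := by simp [nfeδ, hi, hj]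
  have h4 : nfeδ i j 0 = 0 := by simp [nfeδ]
  simp only [h3, h4] at h2
  have : ∑ k ∈ Finset.range N, (w (k+1) - w k) * nfeδ i j (k+1)
    = ∑ k ∈ Finset.range N, (w (k+1) * nfeδ i j (k+1) - w k * nfeδ i j k)
      - ∑ k ∈ Finset.range N, w k * (nfeδ i j (k+1) - nfeδ i j k) := by
    rw [← Finset.sum_sub_distrib]
    exact Finset.sum_congr rfl fun k _ => by ring
  rw [this, h, h2]; ring

noncomputable def nfeIdx (S : ℕ → ℝ) (N : ℕ) (x : ℝ) : ℕ :=
  ∑ k ∈ Finset.range (N - 1), if S (k+1) ≤ x then 1 else 0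

theorem nfeIdx_meas (S : ℕ → ℝ) (N : ℕ) : Measurable (nfeIdx S N) := by
  unfold nfeIdx
  refine Finset.measurable_sum _ fun k _ => ?_
  exact Measurable.ite measurableSet_Ici measurable_const measurable_const

theorem nfeIdx_eq (S : ℕ → ℝ) (hS : Monotone S) (N : ℕ) (x : ℝ) (i : ℕ) (hi : i < N)
    (h1 : S i < x) (h2 : x < S (i+1)) : nfeIdx S N x = i := by
  unfold nfeIdx
  have : ∀ k ∈ Finset.range (N - 1), (if S (k+1) ≤ x then 1 else 0)
      = if k ∈ Finset.range i then 1 else 0 := by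
    intro k hk
    congr 1
    simp only [Finset.mem_range, eq_iff_iff]
    constructor
    · intro h
      by_contra hc
      have := hS (show i + 1 ≤ k + 1 by omega)
      linarith
    · intro h
      have := hS (show k + 1 ≤ i by omega)
      linarith
  rw [Finset.sum_congr rfl this, Finset.sum_ite_mem,
    Finset.inter_eq_right.2 (Finset.range_subset_range.2 (by omega))]
  simp

theorem nfe_loc (S : ℕ → ℝ) (N : ℕ) (r x : ℝ) (h0 : S 0 = 0)
    (hN : ∀ k, N ≤ k → S k = r) (hx : x ∈ Set.Icc 0 r) (hne : ∀ k, x ≠ S k) :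
    ∃ i < N, S i < x ∧ x < S (i+1) := by
  have hex : ∃ k, x < S k := ⟨N, lt_of_le_of_ne (by rw [hN N le_rfl]; exact hx.2) (hne N)⟩
  classical
  obtain ⟨m, hm⟩ : ∃ m, m = Nat.find hex := ⟨_, rfl⟩
  have hs : x < S m := hm ▸ Nat.find_spec hex
  have hle : m ≤ N := hm ▸ Nat.find_min' hex
    (lt_of_le_of_ne (by rw [hN N le_rfl]; exact hx.2) (hne N))
  cases m with
  | zero => rw [h0] at hs; exact absurd hx.1 (not_le.2 hs)
  | succ i =>
    refine ⟨i, hle, ?_, hs⟩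
    have := Nat.find_min hex (show i < Nat.find hex by omega)
    exact lt_of_le_of_ne (not_lt.1 this) (hne i).symm

theorem nfe_vol (S : ℕ → ℝ) (hS : Monotone S) (N : ℕ) (r : ℝ) (h0 : S 0 = 0)
    (hN : ∀ k, N ≤ k → S k = r) (A : ℕ → Prop) [DecidablePred A] :
    (volume {x : ℝ | x ∈ Set.Icc 0 r ∧ A (nfeIdx S N x)}).toReal =
      ∑ k ∈ Finset.range N, (if A k then 1 else 0) * (S (k+1) - S k) := by
  have hr : 0 ≤ r := by rw [← h0, ← hN N le_rfl]; exact hS (Nat.zero_le _)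
  have hA : MeasurableSet {x | A (nfeIdx S N x)} :=
    nfeIdx_meas S N (MeasurableSet.of_discrete (s := {k | A k}))
  have hi : ∀ a b : ℝ, IntervalIntegrable
      (fun x => if A (nfeIdx S N x) then (1:ℝ) else 0) volume a b := by
    intro a b
    refine (intervalIntegrable_const (c := (1:ℝ))).mono_fun
      (Measurable.ite hA measurable_const measurable_const).aestronglyMeasurable ?_
    refine Filter.Eventually.of_forall fun x => ?_
    dsimp only
    split_ifs <;> simp
  have e1 : (volume {x : ℝ | x ∈ Set.Icc 0 r ∧ A (nfeIdx S N x)}).toReal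
      = ∫ x in (0:ℝ)..r, if A (nfeIdx S N x) then (1:ℝ) else 0 := by
    rw [intervalIntegral.integral_of_le hr, ← integral_Icc_eq_integral_Ioc]
    have : (fun x => if A (nfeIdx S N x) then (1:ℝ) else 0)
      = Set.indicator {x | A (nfeIdx S N x)} (fun _ => 1) := by
      ext x; simp [Set.indicator_apply]
    rw [this, integral_indicator hA, Measure.restrict_restrict hA]
    simp only [integral_const, smul_eq_mul, mul_one, Measure.real, MeasurableSet.univ,
      Measure.restrict_apply, Set.univ_inter]
    congr 2
    ext x; simp [and_comm]
  have e2 := intervalIntegral.sum_integral_adjacent_intervals (μ := volume) (a := S) (n := N)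
    (f := fun x => if A (nfeIdx S N x) then (1:ℝ) else 0) (fun k _ => hi _ _)
  rw [h0, hN N le_rfl] at e2
  rw [e1, ← e2]
  refine Finset.sum_congr rfl fun k hk => ?_
  have hk' := Finset.mem_range.1 hk
  have e3 : ∫ x in S k..S (k+1), (if A (nfeIdx S N x) then (1:ℝ) else 0)
      = ∫ x in S k..S (k+1), (if A k then (1:ℝ) else 0) := by
    rw [intervalIntegral.integral_of_le (hS (Nat.le_succ k)),
      intervalIntegral.integral_of_le (hS (Nat.le_succ k)), integral_Ioc_eq_integral_Ioo,
      integral_Ioc_eq_integral_Ioo]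
    refine setIntegral_congr_fun measurableSet_Ioo fun x hx => ?_
    rw [nfeIdx_eq S hS N x k hk' hx.1 hx.2]
  rw [e3]
  simp [mul_comm]

theorem nfe_deriv {ι : Type*} [Fintype ι] (g : ι → ℝ → ℝ) (hg : ∀ e, Continuous (g e))
    (f d : ι → ℝ) (m T : ℝ) (hT : 0 < T)
    (h : ∀ t, 0 < t → t ≤ T → t * m ≤ (∑ e, ∫ y in (0:ℝ)..(f e + t * d e), g e y)
      - ∑ e, ∫ y in (0:ℝ)..(f e), g e y) :
    m ≤ ∑ e, d e * g e (f e) := by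
  have hd : HasDerivAt (fun t : ℝ => ∑ e, ∫ y in (0:ℝ)..(f e + t * d e), g e y)
      (∑ e, d e * g e (f e)) 0 := by
    refine HasDerivAt.fun_sum fun e _ => ?_
    have h1 : HasDerivAt (fun u => ∫ y in (0:ℝ)..u, g e y) (g e (f e)) (f e + 0 * d e) := by
      have := (hg e).integral_hasStrictDerivAt 0 (f e)
      simpa using this.hasDerivAt
    have h2 : HasDerivAt (fun t : ℝ => f e + t * d e) (d e) 0 := by
      simpa using ((hasDerivAt_id (0:ℝ)).mul_const (d e)).const_add (f e)
    have := h1.comp (0:ℝ) h2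
    rw [mul_comm]
    exact this
  have hs := hd.tendsto_slope_zero_right
  refine ge_of_tendsto hs ?_
  filter_upwards [Ioc_mem_nhdsGT hT] with t ht
  have := h t ht.1 ht.2
  simp only [zero_add, zero_mul, add_zero, smul_eq_mul]
  rw [inv_mul_eq_div, le_div_iff₀ ht.1]
  linarith

/-- Lemma 2, existence: every slowdown-sensitivity game
`(G, β, γ)` with `γ ≥ 0` admits a Nash flow. -/
theorem nash_flow_exists (G : RoutingProblem) (β : G.C → ℝ → ℝ)
    (hβ : G.IsSensitivity β) (γ : ℝ) (hγ : 0 ≤ γ) :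
    ∃ σ : G.C → ℝ → Finset G.E, G.IsNashFlow β γ σ := by
  classical
  set W : Finset G.E → ℝ := fun q => ∑ e ∈ q, G.lat e 0 with hW
  have henum : ∀ c, ∃ (p : ℕ → Finset G.E) (N : ℕ), 0 < N ∧ (Monotone fun k => W (p k)) ∧
      (∀ k, p k ∈ G.paths c) ∧ ∀ a ∈ G.paths c, ∃ k < N, p k = a := by
    intro c
    rcases nfe_enum W (G.paths c) with h | h
    · exact absurd h (G.paths_nonempty c).ne_empty
    · exact h
  choose p N hN0 hWm hp hsurj using henum
  set b : G.C → ℝ → ℝ := fun c x => β c (max 0 (min x (G.r c))) with hb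
  have hbm : ∀ c, Monotone (b c) := by
    intro c x y hxy
    have hm : ∀ z, max 0 (min z (G.r c)) ∈ Set.Icc 0 (G.r c) := fun z =>
      ⟨le_max_left _ _, max_le (G.r_pos c).le (min_le_right _ _)⟩
    exact (hβ c).1 (hm x) (hm y) (max_le_max le_rfl (min_le_min hxy le_rfl))
  have hbeq : ∀ c x, x ∈ Set.Icc 0 (G.r c) → b c x = β c x := by
    intro c x hx
    simp [hb, hx.1, hx.2]
  set g : G.E → ℝ → ℝ := fun e y => G.lat e (max y 0) with hg
  have hgc : ∀ e, Continuous (g e) := fun e =>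
    (G.lat_smooth e).continuousOn.comp_continuous (by fun_prop) (fun y => Set.mem_Ici.2 (le_max_right _ _))
  have hgeq : ∀ e y, 0 ≤ y → g e y = G.lat e y := by
    intro e y hy; simp [hg, hy]
  set F : (G.C → ℕ → ℝ) → G.E → ℝ := fun S e =>
    ∑ c, ∑ k ∈ Finset.range (N c), (if e ∈ p c k then 1 else 0) * (S c (k+1) - S c k) with hF
  set R : (G.C → ℕ → ℝ) → ℝ := fun S =>
    ∑ c, ∑ k ∈ Finset.range (N c), (W (p c (k+1)) - W (p c k)) *
      ∫ t in (0:ℝ)..(S c (k+1)), b c t with hR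
  set Φ : (G.C → ℕ → ℝ) → ℝ := fun S =>
    (∑ e, ∫ y in (0:ℝ)..(F S e), g e y) + γ * R S with hΦ
  set K : Set (G.C → ℕ → ℝ) := {S | ∀ c, Monotone (S c) ∧ S c 0 = 0 ∧
    ∀ k, N c ≤ k → S c k = G.r c} with hK
  have hKcl : IsClosed K := by
    have : K = ⋂ c, ((⋂ (k : ℕ), {S : G.C → ℕ → ℝ | S c k ≤ S c (k+1)}) ∩
        {S | S c 0 = 0} ∩ ⋂ (k : ℕ) (_ : N c ≤ k), {S | S c k = G.r c}) := by
      ext S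
      simp only [hK, Set.mem_setOf_eq, Set.mem_iInter, Set.mem_inter_iff, and_assoc]
      refine forall_congr' fun c => and_congr_left fun _ => ?_
      exact ⟨fun h k => h (Nat.le_succ k), monotone_nat_of_le_succ⟩
    rw [this]
    refine isClosed_iInter fun c => ((isClosed_iInter fun k => ?_).inter ?_).inter
      (isClosed_iInter fun k => isClosed_iInter fun _ => ?_)
    · exact isClosed_le (by fun_prop) (by fun_prop)
    · exact isClosed_eq (by fun_prop) (by fun_prop)
    · exact isClosed_eq (by fun_prop) (by fun_prop)
  have hKc : IsCompact K := by
    refine (isCompact_univ_pi (fun c : G.C => isCompact_univ_pi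
      (fun _ : ℕ => isCompact_Icc (a := (0:ℝ)) (b := G.r c)))).of_isClosed_subset hKcl ?_
    intro S hS c _ k _
    obtain ⟨h1, h2, h3⟩ := hS c
    refine ⟨?_, ?_⟩
    · rw [← h2]; exact h1 (Nat.zero_le k)
    · rw [← h3 (max k (N c)) (le_max_right _ _)]; exact h1 (le_max_left _ _)
  have hKne : K.Nonempty := by
    refine ⟨fun c k => if k = 0 then 0 else G.r c, fun c => ⟨?_, by simp, ?_⟩⟩
    · refine monotone_nat_of_le_succ fun k => ?_
      by_cases h : k = 0 <;> simp [h, (G.r_pos c).le]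
    · intro k hk
      have := hN0 c
      have : k ≠ 0 := by omega
      simp [this]
  have hFc : ∀ e, Continuous fun S => F S e := by
    intro e; simp only [hF]; fun_prop
  have hprim : ∀ c, Continuous fun u => ∫ t in (0:ℝ)..u, b c t := fun c =>
    intervalIntegral.continuous_primitive (fun _ _ => (hbm c).intervalIntegrable) 0
  have hgprim : ∀ e, Continuous fun u => ∫ t in (0:ℝ)..u, g e t := fun e =>
    intervalIntegral.continuous_primitive (fun _ _ => (hgc e).intervalIntegrable _ _) 0
  have hΦc : Continuous Φ := by
    refine (continuous_finsetSum _ fun e _ => (hgprim e).comp (hFc e)).add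
      (continuous_const.mul (continuous_finsetSum _ fun c _ => continuous_finsetSum _
        fun k _ => continuous_const.mul ((hprim c).comp (by fun_prop))))
  obtain ⟨S, hSK, hmin⟩ := hKc.exists_isMinOn hKne hΦc.continuousOn
  set σ : G.C → ℝ → Finset G.E := fun c x => p c (nfeIdx (S c) (N c) x) with hσ
  have hflow : G.edgeFlow σ = F S := by
    ext e
    simp only [RoutingProblem.edgeFlow, hF]
    refine Finset.sum_congr rfl fun c _ => ?_
    obtain ⟨h1, h2, h3⟩ := hSK c
    exact nfe_vol (S c) h1 (N c) (G.r c) h2 h3 (fun k => e ∈ p c k)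
  refine ⟨σ, ⟨fun c x _ => hp c _, fun c q => ?_⟩, fun c => ?_⟩
  · exact nfeIdx_meas (S c) (N c) (MeasurableSet.of_discrete (s := {k | p c k = q}))
  obtain ⟨h1, h2, h3⟩ := hSK c
  have hae : ∀ᵐ x ∂(volume.restrict (Set.Icc 0 (G.r c))), ∀ k, x ≠ S c k :=
    ae_all_iff.2 fun k => ae_restrict_of_ae (Measure.ae_ne volume (S c k))
  filter_upwards [hae, ae_restrict_mem measurableSet_Icc] with x hne hx q hq
  obtain ⟨i, hi, hi1, hi2⟩ := nfe_loc (S c) (N c) (G.r c) x h2 h3 hx hne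
  obtain ⟨j, hj, rfl⟩ := hsurj c q hq
  have hσx : σ c x = p c i := by
    simp only [hσ]; rw [nfeIdx_eq (S c) h1 (N c) x i hi hi1 hi2]
  rw [hσx, hflow]
  have hFnn : ∀ e, 0 ≤ F S e := by
    intro e
    refine Finset.sum_nonneg fun c' _ => Finset.sum_nonneg fun k _ => mul_nonneg ?_ ?_
    · split_ifs <;> norm_num
    · exact sub_nonneg.2 ((hSK c').1 (Nat.le_succ k))
  -- directional optimality
  have key := nfe_deriv g hgc (F S)
    (fun e => (if e ∈ p c j then (1:ℝ) else 0) - if e ∈ p c i then 1 else 0)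
    (γ * b c x * (W (p c j) - W (p c i))) (min (x - S c i) (S c (i+1) - x))
    (lt_min (by linarith) (by linarith)) (by
      intro t ht htT
      have ht1 : t ≤ x - S c i := htT.trans (min_le_left _ _)
      have ht2 : t ≤ S c (i+1) - x := htT.trans (min_le_right _ _)
      set S' : G.C → ℕ → ℝ := fun c' k => S c' k + if c' = c then t * nfeδ i j k else 0 with hS'
      have hS'K : S' ∈ K := by
        intro c'
        by_cases hc : c' = c
        · subst hc
          refine ⟨monotone_nat_of_le_succ fun k => ?_, by simp [hS', h2, nfeδ], ?_⟩
          · have e1 := nfeδ_succ i j k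
            have e2 := h1 (Nat.le_succ k)
            simp only [hS', if_true]
            have e3 : t * nfeδ i j (k+1) - t * nfeδ i j k =
              t * ((if k = j then 1 else 0) - (if k = i then 1 else 0)) := by rw [← e1]; ring
            have e4 : -(S c' (k+1) - S c' k) ≤
                t * ((if k = j then 1 else 0) - (if k = i then 1 else 0)) := by
              simp only [Nat.succ_eq_add_one] at e2
              by_cases hki : k = i
              · subst hki
                by_cases hkj : k = j
                · simp [hkj]; subst hkj; exact e2
                · simp [hkj]; linarith
              · by_cases hkj : k = j
                · simp [hki, hkj]; subst hkj; simp [hki]; linarith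
                · simp [hki, hkj]; exact e2
            linarith
          · intro k hk
            have a1 : j < k := by omega
            have a2 : i < k := by omega
            simp [hS', h3 k hk, nfeδ, a1, a2]
        · simpa [hS', hc] using hSK c'
      have hle : Φ S ≤ Φ S' := hmin hS'K
      have hFS' : ∀ e, F S' e = F S e +
          t * ((if e ∈ p c j then (1:ℝ) else 0) - if e ∈ p c i then 1 else 0) := by
        intro e
        rw [← sub_eq_iff_eq_add']
        simp only [hF]
        rw [← Finset.sum_sub_distrib, Finset.sum_eq_single c]
        · rw [← nfe_sum1 (fun k => if e ∈ p c k then (1:ℝ) else 0) (N c) i j hi hj,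
            ← Finset.sum_sub_distrib, Finset.mul_sum]
          refine Finset.sum_congr rfl fun k _ => ?_
          simp only [hS', if_true]; ring
        · intro c' _ hc; simp [hS', hc]
        · simp
      have hRS' : R S' - R S ≤ t * b c x * (W (p c i) - W (p c j)) := by
        simp only [hR]
        rw [← Finset.sum_sub_distrib, Finset.sum_eq_single c]
        · rw [← nfe_sum2 (fun k => W (p c k)) (N c) i j hi hj,
            ← Finset.sum_sub_distrib, Finset.mul_sum]
          refine Finset.sum_le_sum fun k _ => ?_
          have hw : 0 ≤ W (p c (k+1)) - W (p c k) := sub_nonneg.2 (hWm c (Nat.le_succ k))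
          have hpr : (∫ y in (0:ℝ)..(S' c (k+1)), b c y) - (∫ y in (0:ℝ)..(S c (k+1)), b c y)
              ≤ t * nfeδ i j (k+1) * b c x := by
            have e5 : S' c (k+1) - S c (k+1) = t * nfeδ i j (k+1) := by simp [hS']
            by_cases a1 : j < k+1 <;> by_cases a2 : i < k+1
            · have : S' c (k+1) = S c (k+1) := by simp [hS', nfeδ, a1, a2]
              rw [← e5, this]; simp
            · rw [← e5]
              refine nfe_prim (b c) (hbm c) x _ _ (Or.inr ?_)
              have : S' c (k+1) = S c (k+1) + t := by simp [hS', nfeδ, a1, a2]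
              have := h1 (show k + 1 ≤ i by omega)
              constructor <;> linarith
            · rw [← e5]
              refine nfe_prim (b c) (hbm c) x _ _ (Or.inl ?_)
              have : S' c (k+1) = S c (k+1) - t := by
                simp [hS', nfeδ, a1, a2]; ring
              have := h1 (show i + 1 ≤ k + 1 by omega)
              constructor <;> linarith
            · have : S' c (k+1) = S c (k+1) := by simp [hS', nfeδ, a1, a2]
              rw [← e5, this]; simp
          have := mul_le_mul_of_nonneg_left hpr hw
          linarith
        · intro c' _ hc; simp [hS', hc]
        · simp
      have h6 := mul_le_mul_of_nonneg_left hRS' hγ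
      simp only [hΦ, hFS'] at hle
      linarith)
  rw [hbeq c x hx] at key
  have hsum : ∑ e, ((if e ∈ p c j then (1:ℝ) else 0) - if e ∈ p c i then 1 else 0) * g e (F S e)
      = ∑ e ∈ p c j, G.lat e (F S e) - ∑ e ∈ p c i, G.lat e (F S e) := by
    simp only [sub_mul, Finset.sum_sub_distrib, ite_mul, one_mul, zero_mul, Finset.sum_ite_mem,
      Finset.univ_inter, hgeq _ _ (hFnn _)]
  rw [hsum] at key
  simp only [RoutingProblem.cost, Finset.sum_sub_distrib, ← Finset.mul_sum]
  simp only [hW] at key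
  linarith
end

section
/- (Lemma 2, part 2: convexity of the equilibrium set.) Fix a routing problem G, a sensitivity distribution β, and γ ≥ 0. If f and f′ are the path-flow vectors induced by two Nash flows of (G, β, γ), then for every λ ∈ [0, 1] the convex combination λf + (1−λ)f′ is the path-flow vector induced by some Nash flow of (G, β, γ). In particular, the set of Nash path-flow vectors of (G, β, γ) is a convex subset of ℝ^{|𝒫|}. -/
open MeasureTheory

namespace NashConvexAux

/-- Splitting the volume of a finite-volume set along the fibers of two finite-valued maps. -/
lemma split {α : Type} [Fintype α] (s s' : ℝ → α)
    (hs : ∀ a, MeasurableSet {x : ℝ | s x = a}) (hs' : ∀ a, MeasurableSet {x : ℝ | s' x = a})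
    (T : Set ℝ) (hT : volume T ≠ ⊤) :
    (volume T).toReal = ∑ a, ∑ b, (volume {x | x ∈ T ∧ s x = a ∧ s' x = b}).toReal := by
  classical
  have h1 : volume T = ∑ ab : α × α, volume {x | x ∈ T ∧ s x = ab.1 ∧ s' x = ab.2} := by
    have key := measure_iUnion (μ := volume.restrict T)
      (f := fun ab : α × α => {x : ℝ | s x = ab.1} ∩ {x : ℝ | s' x = ab.2}) ?_ ?_
    · rw [tsum_fintype] at key
      have hU : (⋃ ab : α × α, {x : ℝ | s x = ab.1} ∩ {x : ℝ | s' x = ab.2}) = Set.univ := by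
        ext x; simp
      rw [hU, Measure.restrict_apply_univ] at key
      rw [key]
      refine Finset.sum_congr rfl fun ab _ => ?_
      rw [Measure.restrict_apply ((hs _).inter (hs' _))]
      congr 1
      ext x; simp only [Set.mem_inter_iff, Set.mem_setOf_eq]; tauto
    · intro ab ab' hne
      refine Set.disjoint_left.2 ?_
      rintro x ⟨h1, h2⟩ ⟨h3, h4⟩
      simp only [Set.mem_setOf_eq] at h1 h2 h3 h4
      exact hne (Prod.ext (h1.symm.trans h3) (h2.symm.trans h4))
    · intro ab; exact (hs _).inter (hs' _)
  rw [h1, ENNReal.toReal_sum, Fintype.sum_prod_type]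
  intro ab _
  exact ne_top_of_le_ne_top hT (measure_mono fun x hx => hx.1)

lemma sub_top (r : ℝ) (Q : ℝ → Prop) : volume {x : ℝ | x ∈ Set.Icc 0 r ∧ Q x} ≠ ⊤ :=
  ne_top_of_le_ne_top (measure_Icc_lt_top (a := (0:ℝ)) (b := r)).ne
    (measure_mono fun _ hx => hx.1)

/-- Cutting a bounded measurable set in a prescribed proportion. -/
lemma cut (r : ℝ) (hr : 0 < r) (B : Set ℝ) (hB : B ⊆ Set.Icc 0 r)
    (lam : ℝ) (hlam : lam ∈ Set.Icc (0:ℝ) 1) :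
    ∃ t : ℝ, (volume (B ∩ Set.Iic t)).toReal = lam * (volume B).toReal ∧
      (volume (B \ Set.Iic t)).toReal = (1 - lam) * (volume B).toReal := by
  have hBt : volume B ≠ ⊤ :=
    ne_top_of_le_ne_top (measure_Icc_lt_top (a := (0:ℝ)) (b := r)).ne (measure_mono hB)
  set F : ℝ → ℝ := fun t => (volume (B ∩ Set.Iic t)).toReal with hF
  have hft : ∀ t, volume (B ∩ Set.Iic t) ≠ ⊤ := fun t =>
    ne_top_of_le_ne_top hBt (measure_mono Set.inter_subset_left)
  have hmono : ∀ s t, s ≤ t → F s ≤ F t ∧ F t ≤ F s + (t - s) := by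
    intro s t hst
    constructor
    · exact ENNReal.toReal_mono (hft t)
        (measure_mono (Set.inter_subset_inter_right _ (Set.Iic_subset_Iic.2 hst)))
    · have : volume (B ∩ Set.Iic t) ≤ volume (B ∩ Set.Iic s) + volume (Set.Ioc s t) := by
        refine (measure_mono ?_).trans (measure_union_le _ _)
        rintro x ⟨h1, h2⟩
        by_cases h : x ≤ s
        · exact Or.inl ⟨h1, h⟩
        · exact Or.inr ⟨not_le.1 h, h2⟩
      have h2 := ENNReal.toReal_mono (by simp [hft s]) this
      rw [ENNReal.toReal_add (hft s) (by simp), Real.volume_Ioc,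
        ENNReal.toReal_ofReal (by linarith)] at h2
      exact h2
  have hcont : Continuous F := by
    have : LipschitzWith 1 F := by
      refine LipschitzWith.of_le_add fun x y => ?_
      rw [Real.dist_eq]
      rcases le_total x y with h | h
      · have := (hmono x y h).1
        have := abs_nonneg (x - y)
        linarith
      · have := (hmono y x h).2
        have := le_abs_self (x - y)
        linarith
    exact this.continuous
  have h0 : F 0 = 0 := by
    have : volume (B ∩ Set.Iic 0) ≤ volume ({0} : Set ℝ) := measure_mono (by
      rintro x ⟨h1, h2⟩
      exact le_antisymm h2 (hB h1).1)
    rw [Real.volume_singleton] at this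
    simp [hF, le_antisymm this bot_le]
  have h1 : F r = (volume B).toReal := by
    have : B ∩ Set.Iic r = B := Set.inter_eq_left.2 fun x hx => (hB hx).2
    simp [hF, this]
  have hnn : 0 ≤ (volume B).toReal := ENNReal.toReal_nonneg
  obtain ⟨t, -, ht⟩ := intermediate_value_Icc hr.le hcont.continuousOn
    (show lam * (volume B).toReal ∈ Set.Icc (F 0) (F r) by
      rw [h0, h1]
      exact ⟨mul_nonneg hlam.1 hnn, by nlinarith [hlam.2]⟩)
  refine ⟨t, ht, ?_⟩
  have h3 := measure_inter_add_diff (μ := volume) B (measurableSet_Iic (a := t))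
  have h4 := congrArg ENNReal.toReal h3
  rw [ENNReal.toReal_add (hft t)
    (ne_top_of_le_ne_top hBt (measure_mono Set.diff_subset))] at h4
  have : (volume (B ∩ Set.Iic t)).toReal = lam * (volume B).toReal := ht
  linarith

/-- Mixing two finite-valued maps in a prescribed proportion. -/
lemma mix {α : Type} [Fintype α] (r : ℝ) (hr : 0 < r) (s s' : ℝ → α)
    (hs : ∀ a, MeasurableSet {x : ℝ | s x = a}) (hs' : ∀ a, MeasurableSet {x : ℝ | s' x = a})
    (lam : ℝ) (hlam : lam ∈ Set.Icc (0:ℝ) 1) :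
    ∃ w : ℝ → α, (∀ x, w x = s x ∨ w x = s' x) ∧ (∀ a, MeasurableSet {x : ℝ | w x = a}) ∧
      ∀ P : α → Prop, (volume {x : ℝ | x ∈ Set.Icc 0 r ∧ P (w x)}).toReal =
        lam * (volume {x : ℝ | x ∈ Set.Icc 0 r ∧ P (s x)}).toReal +
        (1 - lam) * (volume {x : ℝ | x ∈ Set.Icc 0 r ∧ P (s' x)}).toReal := by
  classical
  choose t ht ht' using fun a b => cut r hr {x | x ∈ Set.Icc 0 r ∧ s x = a ∧ s' x = b}
    (fun x hx => hx.1) lam hlam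
  refine ⟨fun x => if x ≤ t (s x) (s' x) then s x else s' x, ?_, ?_, ?_⟩
  · intro x
    by_cases h : x ≤ t (s x) (s' x) <;> simp [h]
  · intro p
    have : {x : ℝ | (if x ≤ t (s x) (s' x) then s x else s' x) = p} =
        ⋃ a, ⋃ b, ({x | s x = a} ∩ {x | s' x = b}) ∩
          {x | (if x ≤ t a b then a else b) = p} := by
      ext x; simp
    rw [this]
    refine MeasurableSet.iUnion fun a => MeasurableSet.iUnion fun b =>
      ((hs a).inter (hs' b)).inter ?_
    have : {x : ℝ | (if x ≤ t a b then a else b) = p} =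
        (Set.Iic (t a b) ∩ {_x | a = p}) ∪ ((Set.Iic (t a b))ᶜ ∩ {_x | b = p}) := by
      ext x
      by_cases h : x ≤ t a b <;> simp [h, not_lt.2, not_le.1]
    rw [this]
    exact (measurableSet_Iic.inter (MeasurableSet.const _)).union
      (measurableSet_Iic.compl.inter (MeasurableSet.const _))
  · intro P
    rw [split s s' hs hs' _ (sub_top r _), split s s' hs hs' _ (sub_top r (fun x => P (s x))),
      split s s' hs hs' _ (sub_top r (fun x => P (s' x)))]
    simp only [Finset.mul_sum, ← Finset.sum_add_distrib]
    refine Finset.sum_congr rfl fun a _ => Finset.sum_congr rfl fun b _ => ?_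
    have e1 : {x | x ∈ {x | x ∈ Set.Icc 0 r ∧ P (s x)} ∧ s x = a ∧ s' x = b} =
        if P a then {x | x ∈ Set.Icc 0 r ∧ s x = a ∧ s' x = b} else ∅ := by
      ext x; by_cases h : P a <;> simp only [h, if_true, if_false] <;> simp <;> grind
    have e2 : {x | x ∈ {x | x ∈ Set.Icc 0 r ∧ P (s' x)} ∧ s x = a ∧ s' x = b} =
        if P b then {x | x ∈ Set.Icc 0 r ∧ s x = a ∧ s' x = b} else ∅ := by
      ext x; by_cases h : P b <;> simp only [h, if_true, if_false] <;> simp <;> grind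
    have e3 : {x | x ∈ {x | x ∈ Set.Icc 0 r ∧
          P (if x ≤ t (s x) (s' x) then s x else s' x)} ∧ s x = a ∧ s' x = b} =
        if P a then (if P b then {x | x ∈ Set.Icc 0 r ∧ s x = a ∧ s' x = b}
            else {x | x ∈ Set.Icc 0 r ∧ s x = a ∧ s' x = b} ∩ Set.Iic (t a b))
          else (if P b then {x | x ∈ Set.Icc 0 r ∧ s x = a ∧ s' x = b} \ Set.Iic (t a b)
            else ∅) := by
      ext x
      by_cases h : P a <;> by_cases h' : P b <;> simp only [h, h', if_true, if_false] <;>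
        simp <;> grind
    rw [e1, e2, e3]
    by_cases h : P a <;> by_cases h' : P b <;> simp only [h, h', if_true, if_false]
    · ring
    · rw [ht]; simp
    · rw [ht']; simp
    · simp

end NashConvexAux

open NashConvexAux in
lemma nash_lat_eq (G : RoutingProblem) (β : G.C → ℝ → ℝ) (γ : ℝ)
    (σ σ' : G.C → ℝ → Finset G.E)
    (hσ : G.IsNashFlow β γ σ) (hσ' : G.IsNashFlow β γ σ') (e : G.E) :
    G.lat e (G.edgeFlow σ e) = G.lat e (G.edgeFlow σ' e) := by
  classical
  set f := G.edgeFlow σ with hf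
  set f' := G.edgeFlow σ' with hf'
  have hf0 : ∀ e, 0 ≤ f e := fun e => Finset.sum_nonneg fun c _ => ENNReal.toReal_nonneg
  have hf0' : ∀ e, 0 ≤ f' e := fun e => Finset.sum_nonneg fun c _ => ENNReal.toReal_nonneg
  set d : G.E → ℝ := fun e => G.lat e (f e) - G.lat e (f' e) with hd
  set m : G.C → Finset G.E → Finset G.E → ℝ := fun c a b =>
    (volume {x | x ∈ Set.Icc 0 (G.r c) ∧ σ c x = a ∧ σ' c x = b}).toReal with hm
  have hfe : ∀ e, f e = ∑ c, ∑ a, ∑ b, if e ∈ a then m c a b else 0 := by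
    intro e
    refine Finset.sum_congr rfl fun c _ => ?_
    rw [split (σ c) (σ' c) (hσ.1.2 c) (hσ'.1.2 c) _ (sub_top _ _)]
    refine Finset.sum_congr rfl fun a _ => Finset.sum_congr rfl fun b _ => ?_
    by_cases h : e ∈ a
    · rw [if_pos h]; simp only [hm]; congr 2; ext x; simp; grind
    · rw [if_neg h, show {x | x ∈ {x | x ∈ Set.Icc 0 (G.r c) ∧ e ∈ σ c x} ∧
        σ c x = a ∧ σ' c x = b} = ∅ by ext x; simp; grind]
      simp
  have hfe' : ∀ e, f' e = ∑ c, ∑ a, ∑ b, if e ∈ b then m c a b else 0 := by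
    intro e
    refine Finset.sum_congr rfl fun c _ => ?_
    rw [split (σ c) (σ' c) (hσ.1.2 c) (hσ'.1.2 c) _ (sub_top _ _)]
    refine Finset.sum_congr rfl fun a _ => Finset.sum_congr rfl fun b _ => ?_
    by_cases h : e ∈ b
    · rw [if_pos h]; simp only [hm]; congr 2; ext x; simp; grind
    · rw [if_neg h, show {x | x ∈ {x | x ∈ Set.Icc 0 (G.r c) ∧ e ∈ σ' c x} ∧
        σ c x = a ∧ σ' c x = b} = ∅ by ext x; simp; grind]
      simp
  have hcell : ∀ c a b, m c a b * (∑ e ∈ a, d e - ∑ e ∈ b, d e) ≤ 0 := by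
    intro c a b
    by_cases h0 : m c a b = 0
    · simp [h0]
    have hpos : volume {x | x ∈ Set.Icc 0 (G.r c) ∧ σ c x = a ∧ σ' c x = b} ≠ 0 := by
      intro h; exact h0 (by simp only [hm]; rw [h]; simp)
    have h1 := (ae_restrict_iff' measurableSet_Icc).1 (hσ.2 c)
    have h2 := (ae_restrict_iff' measurableSet_Icc).1 (hσ'.2 c)
    obtain ⟨x, ⟨hx, hxa, hxb⟩, h3, h4⟩ : ∃ x, x ∈ {x | x ∈ Set.Icc 0 (G.r c) ∧ σ c x = a ∧
        σ' c x = b} ∧ (∀ p ∈ G.paths c, G.cost β γ c x (σ c x) f ≤ G.cost β γ c x p f) ∧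
        (∀ p ∈ G.paths c, G.cost β γ c x (σ' c x) f' ≤ G.cost β γ c x p f') := by
      by_contra hcon
      push Not at hcon
      apply hpos
      have h12 := h1.and h2
      rw [ae_iff] at h12
      refine measure_mono_null ?_ h12
      intro x hx hh
      obtain ⟨p, hp, hlt⟩ := hcon x hx (hh.1 hx.1)
      exact absurd (hh.2 hx.1 p hp) (not_le.2 hlt)
    have h5 := h3 _ (hσ'.1.1 c x hx)
    have h6 := h4 _ (hσ.1.1 c x hx)
    rw [hxa, hxb] at h5 h6
    simp only [RoutingProblem.cost, Finset.sum_sub_distrib] at h5 h6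
    have hm0 : 0 ≤ m c a b := ENNReal.toReal_nonneg
    refine mul_nonpos_of_nonneg_of_nonpos hm0 ?_
    simp only [hd, Finset.sum_sub_distrib]
    linarith
  have hsum : ∑ e, d e * (f e - f' e) =
      ∑ c, ∑ a, ∑ b, m c a b * (∑ e ∈ a, d e - ∑ e ∈ b, d e) := by
    have : ∀ e, d e * (f e - f' e) = ∑ c, ∑ a, ∑ b,
        m c a b * ((if e ∈ a then d e else 0) - (if e ∈ b then d e else 0)) := by
      intro e
      rw [hfe, hfe']
      simp only [← Finset.sum_sub_distrib, Finset.mul_sum]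
      refine Finset.sum_congr rfl fun c _ => Finset.sum_congr rfl fun a _ =>
        Finset.sum_congr rfl fun b _ => ?_
      split_ifs <;> ring
    simp only [this]
    rw [Finset.sum_comm]
    refine Finset.sum_congr rfl fun c _ => ?_
    rw [Finset.sum_comm]
    refine Finset.sum_congr rfl fun a _ => ?_
    rw [Finset.sum_comm]
    refine Finset.sum_congr rfl fun b _ => ?_
    rw [← Finset.mul_sum, Finset.sum_sub_distrib]
    simp
  have hle : ∑ e, d e * (f e - f' e) ≤ 0 := by
    rw [hsum]
    exact Finset.sum_nonpos fun c _ => Finset.sum_nonpos fun a _ =>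
      Finset.sum_nonpos fun b _ => hcell c a b
  have hnn : ∀ e ∈ Finset.univ, 0 ≤ d e * (f e - f' e) := by
    intro e _
    rcases le_total (f e) (f' e) with h | h
    · have := G.lat_mono e (hf0 e) (hf0' e) h
      exact mul_nonneg_of_nonpos_of_nonpos (sub_nonpos.2 this) (sub_nonpos.2 h)
    · have := G.lat_mono e (hf0' e) (hf0 e) h
      exact mul_nonneg (sub_nonneg.2 this) (sub_nonneg.2 h)
  have hz := (Finset.sum_eq_zero_iff_of_nonneg hnn).1 (le_antisymm hle (Finset.sum_nonneg hnn))
    e (Finset.mem_univ e)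
  rcases mul_eq_zero.1 hz with h | h
  · exact sub_eq_zero.1 h
  · rw [sub_eq_zero.1 h]

/-- Lemma 2, convexity: the set of Nash path-flow vectors of
`(G, β, γ)` is convex. -/
theorem nash_pathflows_convex (G : RoutingProblem) (β : G.C → ℝ → ℝ)
    (hβ : G.IsSensitivity β) (γ : ℝ) (hγ : 0 ≤ γ)
    (σ σ' : G.C → ℝ → Finset G.E)
    (hσ : G.IsNashFlow β γ σ) (hσ' : G.IsNashFlow β γ σ')
    (lam : ℝ) (hlam : lam ∈ Set.Icc (0:ℝ) 1) :
    ∃ σ'' : G.C → ℝ → Finset G.E, G.IsNashFlow β γ σ'' ∧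
      ∀ p : Finset G.E,
        G.pathFlow σ'' p = lam * G.pathFlow σ p + (1 - lam) * G.pathFlow σ' p := by
  classical
  choose w hw hwm hwP using fun c => NashConvexAux.mix (G.r c) (G.r_pos c) (σ c) (σ' c)
    (hσ.1.2 c) (hσ'.1.2 c) lam hlam
  have hE : ∀ e, G.edgeFlow w e = lam * G.edgeFlow σ e + (1 - lam) * G.edgeFlow σ' e := by
    intro e
    simp only [RoutingProblem.edgeFlow, Finset.mul_sum, ← Finset.sum_add_distrib]
    exact Finset.sum_congr rfl fun c _ => hwP c (fun p => e ∈ p)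
  have hL := nash_lat_eq G β γ σ σ' hσ hσ'
  have hf0 : ∀ e, 0 ≤ G.edgeFlow σ e :=
    fun e => Finset.sum_nonneg fun c _ => ENNReal.toReal_nonneg
  have hf0' : ∀ e, 0 ≤ G.edgeFlow σ' e :=
    fun e => Finset.sum_nonneg fun c _ => ENNReal.toReal_nonneg
  have hw0 : ∀ e, 0 ≤ G.edgeFlow w e :=
    fun e => Finset.sum_nonneg fun c _ => ENNReal.toReal_nonneg
  have hLw : ∀ e, G.lat e (G.edgeFlow w e) = G.lat e (G.edgeFlow σ e) := by
    intro e
    obtain ⟨hl0, hl1⟩ := hlam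
    rcases le_total (G.edgeFlow σ e) (G.edgeFlow σ' e) with h | h
    · apply le_antisymm
      · rw [hL e]
        exact G.lat_mono e (hw0 e) (hf0' e) (by rw [hE]; nlinarith)
      · exact G.lat_mono e (hf0 e) (hw0 e) (by rw [hE]; nlinarith)
    · apply le_antisymm
      · exact G.lat_mono e (hw0 e) (hf0 e) (by rw [hE]; nlinarith)
      · rw [hL e]
        exact G.lat_mono e (hf0' e) (hw0 e) (by rw [hE]; nlinarith)
  have hc : ∀ c x p, G.cost β γ c x p (G.edgeFlow w) = G.cost β γ c x p (G.edgeFlow σ) := by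
    intro c x p
    simp only [RoutingProblem.cost, hLw]
  have hc' : ∀ c x p, G.cost β γ c x p (G.edgeFlow w) = G.cost β γ c x p (G.edgeFlow σ') := by
    intro c x p
    simp only [RoutingProblem.cost, hLw, hL]
  refine ⟨w, ⟨⟨?_, hwm⟩, ?_⟩, ?_⟩
  · intro c x hx
    rcases hw c x with h | h <;> rw [h]
    · exact hσ.1.1 c x hx
    · exact hσ'.1.1 c x hx
  · intro c
    filter_upwards [hσ.2 c, hσ'.2 c] with x h1 h2 p hp
    rcases hw c x with h | h <;> rw [h]
    · rw [hc, hc]; exact h1 p hp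
    · rw [hc', hc']; exact h2 p hp
  · intro p
    simp only [RoutingProblem.pathFlow, Finset.mul_sum, ← Finset.sum_add_distrib]
    exact Finset.sum_congr rfl fun c _ => hwP c (fun q => q = p)
end

section
/- (Lemma 2, part 3: equilibrium cost invariance.) Fix a routing problem G, a sensitivity distribution β, and γ ≥ 0. Let σ and σ′ be two Nash flows of (G, β, γ) with induced flows f and f′. Then for every commodity c and almost every user x ∈ [0, r^c], the equilibrium cost experienced by x is the same in both equilibria: J^{c,x}(σ^c(x); f) = J^{c,x}(σ′^c(x); f′). -/
open MeasureTheory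

theorem nash_aux_meas (G : RoutingProblem) (σ : G.C → ℝ → Finset G.E)
    (h : G.IsAssignment σ) (c : G.C) (e : G.E) : MeasurableSet {x : ℝ | e ∈ σ c x} := by
  have : {x : ℝ | e ∈ σ c x} = ⋃ p ∈ {p : Finset G.E | e ∈ p}, {x : ℝ | σ c x = p} := by
    ext x; simp
  rw [this]
  exact MeasurableSet.biUnion (Set.to_countable _) (fun p _ => h.2 c p)

theorem nash_aux_flow (G : RoutingProblem) (σ : G.C → ℝ → Finset G.E)
    (h : G.IsAssignment σ) (e : G.E) :
    G.edgeFlow σ e = ∑ c, ∫ x in Set.Icc 0 (G.r c),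
      ({x : ℝ | e ∈ σ c x}).indicator (fun _ => (1:ℝ)) x := by
  unfold RoutingProblem.edgeFlow
  refine Finset.sum_congr rfl fun c _ => ?_
  rw [integral_indicator_const _ (nash_aux_meas G σ h c e), measureReal_restrict_apply
    (nash_aux_meas G σ h c e)]
  simp only [smul_eq_mul, mul_one, Measure.real]
  congr 2
  ext x
  simp [and_comm]

theorem nash_aux_int (G : RoutingProblem) (σ : G.C → ℝ → Finset G.E)
    (h : G.IsAssignment σ) (c : G.C) (e : G.E) :
    Integrable (({x : ℝ | e ∈ σ c x}).indicator (fun _ => (1:ℝ)))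
      (volume.restrict (Set.Icc 0 (G.r c))) :=
  (integrable_const (1:ℝ)).indicator (nash_aux_meas G σ h c e)

theorem nash_aux_sum (G : RoutingProblem) (σ : G.C → ℝ → Finset G.E) (c : G.C) (x : ℝ)
    (w : G.E → ℝ) : ∑ e ∈ σ c x, w e =
      ∑ e, w e * ({x : ℝ | e ∈ σ c x}).indicator (fun _ => (1:ℝ)) x := by
  simp [Set.indicator_apply]

/-- Lemma 2, equilibrium cost invariance: almost every user
experiences the same cost in any two Nash flows of `(G, β, γ)`. -/
theorem nash_cost_invariance (G : RoutingProblem) (β : G.C → ℝ → ℝ)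
    (hβ : G.IsSensitivity β) (γ : ℝ) (hγ : 0 ≤ γ)
    (σ σ' : G.C → ℝ → Finset G.E)
    (hσ : G.IsNashFlow β γ σ) (hσ' : G.IsNashFlow β γ σ') :
    ∀ c, ∀ᵐ x ∂(volume.restrict (Set.Icc 0 (G.r c))),
      G.cost β γ c x (σ c x) (G.edgeFlow σ) =
        G.cost β γ c x (σ' c x) (G.edgeFlow σ') := by
  obtain ⟨hA, hN⟩ := hσ
  obtain ⟨hA', hN'⟩ := hσ'
  have hnn : ∀ (τ : G.C → ℝ → Finset G.E) e, 0 ≤ G.edgeFlow τ e := fun τ e =>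
    Finset.sum_nonneg fun c _ => ENNReal.toReal_nonneg
  have hmem : ∀ c, ∀ᵐ x ∂(volume.restrict (Set.Icc 0 (G.r c))), x ∈ Set.Icc 0 (G.r c) :=
    fun c => ae_restrict_mem measurableSet_Icc
  set w : G.E → ℝ := fun e => G.lat e (G.edgeFlow σ e) - G.lat e (G.edgeFlow σ' e) with hw
  have hterm : ∀ e, 0 ≤ w e * (G.edgeFlow σ e - G.edgeFlow σ' e) := by
    intro e
    rcases le_total (G.edgeFlow σ e) (G.edgeFlow σ' e) with h | h
    · have := G.lat_mono e (hnn σ e) (hnn σ' e) h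
      exact mul_nonneg_of_nonpos_of_nonpos (sub_nonpos.2 this) (sub_nonpos.2 h)
    · have := G.lat_mono e (hnn σ' e) (hnn σ e) h
      exact mul_nonneg (sub_nonneg.2 this) (sub_nonneg.2 h)
  have hpt : ∀ c, ∫ x in Set.Icc 0 (G.r c), (∑ e, w e *
      (({x : ℝ | e ∈ σ c x}).indicator (fun _ => (1:ℝ)) x -
        ({x : ℝ | e ∈ σ' c x}).indicator (fun _ => (1:ℝ)) x)) ≤ 0 := by
    intro c
    apply integral_nonpos_of_ae
    filter_upwards [hN c, hN' c, hmem c] with x h1 h2 hx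
    have h1 := h1 _ (hA'.1 c x hx)
    have h2 := h2 _ (hA.1 c x hx)
    have k1 := nash_aux_sum G σ c x w
    have k2 := nash_aux_sum G σ' c x w
    simp only [mul_sub, Finset.sum_sub_distrib, Pi.zero_apply]
    rw [← k1, ← k2]
    simp only [RoutingProblem.cost, Finset.sum_sub_distrib, hw] at h1 h2 ⊢
    linarith
  have hsum : ∑ e, w e * (G.edgeFlow σ e - G.edgeFlow σ' e) ≤ 0 := by
    have hle := Finset.sum_nonpos (s := Finset.univ) fun c _ => hpt c
    refine le_of_eq_of_le ?_ hle
    have : ∀ c, ∫ x in Set.Icc 0 (G.r c), (∑ e, w e *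
      (({x : ℝ | e ∈ σ c x}).indicator (fun _ => (1:ℝ)) x -
        ({x : ℝ | e ∈ σ' c x}).indicator (fun _ => (1:ℝ)) x)) =
        ∑ e, w e * ((∫ x in Set.Icc 0 (G.r c),
          ({x : ℝ | e ∈ σ c x}).indicator (fun _ => (1:ℝ)) x) -
          ∫ x in Set.Icc 0 (G.r c),
            ({x : ℝ | e ∈ σ' c x}).indicator (fun _ => (1:ℝ)) x) := by
      intro c
      rw [integral_finsetSum]
      · refine Finset.sum_congr rfl fun e _ => ?_
        rw [integral_const_mul, integral_sub (nash_aux_int G σ hA c e)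
          (nash_aux_int G σ' hA' c e)]
      · intro e _
        exact ((nash_aux_int G σ hA c e).sub (nash_aux_int G σ' hA' c e)).const_mul _
    rw [Finset.sum_congr rfl fun c _ => this c, Finset.sum_comm]
    refine Finset.sum_congr rfl fun e _ => ?_
    rw [nash_aux_flow G σ hA e, nash_aux_flow G σ' hA' e, ← Finset.mul_sum,
      Finset.sum_sub_distrib]
  have hz : ∀ e, G.lat e (G.edgeFlow σ e) = G.lat e (G.edgeFlow σ' e) := by
    have h0 := (Finset.sum_eq_zero_iff_of_nonneg (fun e _ => hterm e)).1
      (le_antisymm hsum (Finset.sum_nonneg fun e _ => hterm e))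
    intro e
    rcases mul_eq_zero.1 (h0 e (Finset.mem_univ e)) with h | h
    · exact sub_eq_zero.1 h
    · rw [sub_eq_zero.1 h]
  have hcost : ∀ c x p, G.cost β γ c x p (G.edgeFlow σ) = G.cost β γ c x p (G.edgeFlow σ') := by
    intro c x p
    simp only [RoutingProblem.cost, hz]
  intro c
  filter_upwards [hN c, hN' c, hmem c] with x h1 h2 hx
  have h1 := h1 _ (hA'.1 c x hx)
  have h2 := h2 _ (hA.1 c x hx)
  rw [hcost, hcost] at h1
  rw [hcost]
  exact le_antisymm h1 h2
end

section
/- (Lemma 2: convex potential characterization.) Fix a routing problem G, a sensitivity distribution β, and γ ≥ 0. Define the potential of an assignment σ with induced edge flows f_e by Φ(σ) = Σ_{e ∈ E} ∫_0^{f_e} ℓ_e(t) dt − γ · Σ_{c ∈ 𝒞} ∫_{[0, r^c]} β^c(x) · (Σ_{e ∈ σ^c(x)} ℓ_e(0)) dx. Then Φ is convex as a function of the induced path-flow vector together with the users' choices, and an assignment σ is a Nash flow of (G, β, γ) if and only if σ minimizes Φ over all assignments. -/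
open MeasureTheory

namespace RoutingProblem

lemma exists_cut (r : ℝ) (hr : 0 ≤ r) (S : Set ℝ) (hS : MeasurableSet S) (hSr : S ⊆ Set.Icc 0 r)
    (m : ℝ) (hm0 : 0 ≤ m) (hm : m ≤ volume.real S) :
    ∃ t ∈ Set.Icc 0 r, volume.real (S ∩ Set.Iic t) = m := by
  have hloc : ∀ a b : ℝ, IntervalIntegrable (S.indicator (fun _ => (1:ℝ))) volume a b := by
    intro a b
    rw [intervalIntegrable_iff]
    refine Measure.integrableOn_of_bounded (M := 1) ?_ ?_ ?_
    · simp
    · exact (measurable_const.indicator hS).aestronglyMeasurable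
    · refine Filter.Eventually.of_forall fun x => ?_
      by_cases h : x ∈ S <;> simp [h]
  have hcont : Continuous (fun t => ∫ x in (0:ℝ)..t, S.indicator (fun _ => (1:ℝ)) x) :=
    intervalIntegral.continuous_primitive hloc 0
  have heq : ∀ t, 0 ≤ t → ∫ x in (0:ℝ)..t, S.indicator (fun _ => (1:ℝ)) x
      = volume.real (S ∩ Set.Iic t) := by
    intro t ht
    rw [intervalIntegral.integral_of_le ht, ← integral_Icc_eq_integral_Ioc,
      integral_indicator_const _ hS, measureReal_restrict_apply hS]
    simp only [smul_eq_mul, mul_one]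
    congr 1
    ext x
    constructor
    · rintro ⟨h1, h2⟩; exact ⟨h1, h2.2⟩
    · rintro ⟨h1, h2⟩; exact ⟨h1, (hSr h1).1, h2⟩
  have := intermediate_value_Icc hr hcont.continuousOn
  have hmem : m ∈ Set.Icc (∫ x in (0:ℝ)..0, S.indicator (fun _ => (1:ℝ)) x)
      (∫ x in (0:ℝ)..r, S.indicator (fun _ => (1:ℝ)) x) := by
    refine ⟨by simpa using hm0, ?_⟩
    rw [heq r hr, Set.inter_eq_left.2 (show S ⊆ Set.Iic r from fun x hx => (hSr hx).2)]
    exact hm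
  obtain ⟨t, ht, h⟩ := this hmem
  exact ⟨t, ht, by rw [← heq t ht.1]; exact h⟩

lemma cut_le (r : ℝ) (hr : 0 ≤ r) (b : ℝ → ℝ) (hb : MonotoneOn b (Set.Icc 0 r))
    (hbi : IntegrableOn b (Set.Icc 0 r))
    (S : Set ℝ) (hS : MeasurableSet S) (hSr : S ⊆ Set.Icc 0 r)
    (lam : ℝ) (h0 : 0 ≤ lam) (h1 : lam ≤ 1) :
    ∃ A : Set ℝ, MeasurableSet A ∧ volume.real (S ∩ A) = lam * volume.real S ∧
      ∫ x in S ∩ A, b x ≤ lam * ∫ x in S, b x := by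
  obtain ⟨t, ht, hv⟩ := exists_cut r hr S hS hSr (lam * volume.real S)
    (by positivity) (mul_le_of_le_one_left measureReal_nonneg h1)
  have hSfin : volume S ≠ ⊤ :=
    ne_top_of_le_ne_top (by simp) (measure_mono hSr)
  refine ⟨Set.Iic t, measurableSet_Iic, hv, ?_⟩
  have hsplit := integral_inter_add_sdiff (μ := volume) (f := b) (s := S)
    (measurableSet_Iic (a := t)) (hbi.mono_set hSr)
  have hvs := measureReal_inter_add_sdiff (μ := volume) (s := S) (measurableSet_Iic (a := t)) hSfin
  have hA : ∫ x in S ∩ Set.Iic t, b x ≤ b t * volume.real (S ∩ Set.Iic t) := by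
    have : ∫ x in S ∩ Set.Iic t, b x ≤ ∫ x in S ∩ Set.Iic t, b t := by
      refine setIntegral_mono_on (hbi.mono_set (Set.inter_subset_left.trans hSr)) ?_
        (hS.inter measurableSet_Iic) ?_
      · exact integrableOn_const (ne_top_of_le_ne_top hSfin (measure_mono Set.inter_subset_left))
      · exact fun x hx => hb (hSr hx.1) ht hx.2
    simpa [mul_comm] using this
  have hB : b t * volume.real (S \ Set.Iic t) ≤ ∫ x in S \ Set.Iic t, b x := by
    have : ∫ x in S \ Set.Iic t, b t ≤ ∫ x in S \ Set.Iic t, b x := by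
      refine setIntegral_mono_on ?_ (hbi.mono_set (Set.sdiff_subset.trans hSr))
        (hS.diff measurableSet_Iic) ?_
      · exact integrableOn_const (ne_top_of_le_ne_top hSfin (measure_mono Set.sdiff_subset))
      · exact fun x hx => hb ht (hSr hx.1) (le_of_lt (not_le.1 hx.2))
    simpa [mul_comm] using this
  have e1 := mul_le_mul_of_nonneg_left hA (sub_nonneg.2 h1)
  have e2 := mul_le_mul_of_nonneg_left hB h0
  have e3 : volume.real (S \ Set.Iic t) = (1 - lam) * volume.real S := by linarith
  rw [hv] at e1
  rw [e3] at e2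
  rw [← hsplit]
  nlinarith

lemma cell (r : ℝ) (hr : 0 ≤ r) (b : ℝ → ℝ) (hb : MonotoneOn b (Set.Icc 0 r))
    (hbi : IntegrableOn b (Set.Icc 0 r))
    (S : Set ℝ) (hS : MeasurableSet S) (hSr : S ⊆ Set.Icc 0 r)
    (lam : ℝ) (h0 : 0 ≤ lam) (h1 : lam ≤ 1) (u v : ℝ) :
    ∃ A : Set ℝ, MeasurableSet A ∧ volume.real (S ∩ A) = lam * volume.real S ∧
      lam * (u * ∫ x in S, b x) + (1 - lam) * (v * ∫ x in S, b x)
        ≤ u * (∫ x in S ∩ A, b x) + v * ∫ x in S \ A, b x := by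
  have hSfin : volume S ≠ ⊤ :=
    ne_top_of_le_ne_top (by simp) (measure_mono hSr)
  rcases le_total u v with huv | huv
  · obtain ⟨A, hA, hv, hi⟩ := cut_le r hr b hb hbi S hS hSr lam h0 h1
    refine ⟨A, hA, hv, ?_⟩
    have hsplit := integral_inter_add_sdiff (μ := volume) (f := b) (s := S) hA (hbi.mono_set hSr)
    rw [← sub_eq_iff_eq_add'.2 hsplit.symm]
    nlinarith [mul_le_mul_of_nonneg_left hi (sub_nonneg.2 huv)]
  · obtain ⟨A, hA, hv, hi⟩ := cut_le r hr b hb hbi S hS hSr (1 - lam) (by linarith) (by linarith)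
    have hsplit := integral_inter_add_sdiff (μ := volume) (f := b) (s := S) hA (hbi.mono_set hSr)
    have hvs := measureReal_inter_add_sdiff (μ := volume) (s := S) hA hSfin
    refine ⟨Aᶜ, hA.compl, ?_, ?_⟩
    · rw [← Set.sdiff_eq]; linarith
    · rw [← Set.sdiff_eq, Set.sdiff_compl]
      rw [← sub_eq_iff_eq_add'.2 hsplit.symm]
      nlinarith [mul_le_mul_of_nonneg_left hi (sub_nonneg.2 huv)]

variable {G : RoutingProblem}

lemma meas_comp {s : ℝ → Finset G.E} (hs : ∀ p, MeasurableSet {x | s x = p})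
    (h : Finset G.E → ℝ) : Measurable (fun x => h (s x)) := by
  let _ : MeasurableSpace (Finset G.E) := ⊤
  have : Measurable s := measurable_to_countable' (fun p => hs p)
  exact measurable_from_top.comp this

lemma integ_w {s : ℝ → Finset G.E} (hs : ∀ p, MeasurableSet {x | s x = p})
    (h : Finset G.E → ℝ) (r : ℝ) (w : ℝ → ℝ) (hw : Measurable w)
    (hwb : ∀ x ∈ Set.Icc 0 r, w x ∈ Set.Icc (0:ℝ) 1) :
    IntegrableOn (fun x => w x * h (s x)) (Set.Icc 0 r) := by
  refine Measure.integrableOn_of_bounded (M := ∑ p, |h p|) (by simp)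
    (hw.mul (meas_comp hs h)).aestronglyMeasurable ?_
  rw [ae_restrict_iff' measurableSet_Icc]
  refine Filter.Eventually.of_forall fun x hx => ?_
  rw [Real.norm_eq_abs, abs_mul, abs_of_nonneg (hwb x hx).1]
  have h2 : |h (s x)| ≤ ∑ p, |h p| :=
    Finset.single_le_sum (f := fun p => |h p|) (fun p _ => abs_nonneg _) (Finset.mem_univ _)
  have := mul_le_of_le_one_left (abs_nonneg (h (s x))) (hwb x hx).2
  linarith

lemma integ {s : ℝ → Finset G.E} (hs : ∀ p, MeasurableSet {x | s x = p})
    (h : Finset G.E → ℝ) (r : ℝ) :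
    IntegrableOn (fun x => h (s x)) (Set.Icc 0 r) := by
  simpa using integ_w hs h r (fun _ => 1) measurable_const (by simp)

lemma vol_eq {s : ℝ → Finset G.E} (hs : ∀ p, MeasurableSet {x | s x = p})
    (P : Finset G.E → Prop) [DecidablePred P] (r : ℝ) :
    (volume {x : ℝ | x ∈ Set.Icc 0 r ∧ P (s x)}).toReal
      = ∫ x in Set.Icc 0 r, (if P (s x) then (1:ℝ) else 0) := by
  have hm : MeasurableSet {x | P (s x)} := by
    let _ : MeasurableSpace (Finset G.E) := ⊤
    have : Measurable s := measurable_to_countable' (fun p => hs p)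
    exact this (t := {p | P p}) trivial
  have : (fun x => if P (s x) then (1:ℝ) else 0) = {x | P (s x)}.indicator (fun _ => 1) := by
    ext x; simp [Set.indicator_apply]
  rw [this, integral_indicator_const _ hm, measureReal_restrict_apply hm, smul_eq_mul, mul_one,
    Measure.real]
  congr 2
  ext x
  simp [and_comm]

lemma edgeFlow_eq {σ : G.C → ℝ → Finset G.E} (hσ : G.IsAssignment σ) (e : G.E) :
    G.edgeFlow σ e = ∑ c, ∫ x in Set.Icc 0 (G.r c), (if e ∈ σ c x then (1:ℝ) else 0) :=
  Finset.sum_congr rfl fun c _ => vol_eq (hσ.2 c) (fun p => e ∈ p) _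

lemma pathFlow_eq {σ : G.C → ℝ → Finset G.E} (hσ : G.IsAssignment σ) (p : Finset G.E) :
    G.pathFlow σ p = ∑ c, ∫ x in Set.Icc 0 (G.r c), (if σ c x = p then (1:ℝ) else 0) :=
  Finset.sum_congr rfl fun c _ => vol_eq (hσ.2 c) (fun q => q = p) _

lemma edgeFlow_nonneg (σ : G.C → ℝ → Finset G.E) (e : G.E) : 0 ≤ G.edgeFlow σ e :=
  Finset.sum_nonneg fun _ _ => ENNReal.toReal_nonneg

lemma sum_flow {σ : G.C → ℝ → Finset G.E} (hσ : G.IsAssignment σ) (a : G.E → ℝ) :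
    ∑ e, a e * G.edgeFlow σ e = ∑ c, ∫ x in Set.Icc 0 (G.r c), ∑ e ∈ σ c x, a e := by
  simp_rw [edgeFlow_eq hσ, Finset.mul_sum]
  rw [Finset.sum_comm]
  refine Finset.sum_congr rfl fun c _ => ?_
  simp_rw [← integral_const_mul]
  rw [← integral_finsetSum]
  · refine integral_congr_ae (Filter.Eventually.of_forall fun x => ?_)
    simp
  · intro e _
    exact (integ (hσ.2 c) (fun p => if e ∈ p then (1:ℝ) else 0) _).const_mul _

lemma lat_int (e : G.E) {a b : ℝ} (ha : 0 ≤ a) (hb : 0 ≤ b) :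
    IntervalIntegrable (G.lat e) volume a b := by
  refine ContinuousOn.intervalIntegrable ((G.lat_smooth e).continuousOn.mono ?_)
  intro x hx
  exact le_trans (le_min ha hb) hx.1

lemma tangent (e : G.E) {z y : ℝ} (hz : 0 ≤ z) (hy : 0 ≤ y) :
    (∫ t in (0:ℝ)..z, G.lat e t) + G.lat e z * (y - z) ≤ ∫ t in (0:ℝ)..y, G.lat e t := by
  have := intervalIntegral.integral_add_adjacent_intervals
    (lat_int e le_rfl hz) (lat_int e hz hy)
  rw [← this]
  have key : G.lat e z * (y - z) ≤ ∫ t in z..y, G.lat e t := by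
    rcases le_total z y with h | h
    · have := intervalIntegral.integral_mono_on h (intervalIntegrable_const (c := G.lat e z))
        (lat_int e hz hy) (fun x hx => G.lat_mono e hz (le_trans hz hx.1) hx.1)
      simpa [mul_comm] using this
    · have := intervalIntegral.integral_mono_on h (lat_int e hy hz)
        (intervalIntegrable_const (c := G.lat e z))
        (fun x hx => G.lat_mono e (le_trans hy hx.1) hz hx.2)
      rw [intervalIntegral.integral_symm]
      simp at this
      linarith
  linarith

lemma cost_eq (β : G.C → ℝ → ℝ) (γ : ℝ) (c : G.C) (x : ℝ) (p : Finset G.E) (f : G.E → ℝ) :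
    G.cost β γ c x p f
      = (∑ e ∈ p, G.lat e (f e)) - γ * (β c x * ∑ e ∈ p, G.lat e 0) := by
  simp only [cost, Finset.sum_sub_distrib, Finset.mul_sum]
  congr 1
  exact Finset.sum_congr rfl fun _ _ => by ring

lemma cost_integ {β : G.C → ℝ → ℝ} (hβ : G.IsSensitivity β) (γ : ℝ)
    {σ : G.C → ℝ → Finset G.E} (hσ : G.IsAssignment σ) (c : G.C) (f : G.E → ℝ) :
    IntegrableOn (fun x => G.cost β γ c x (σ c x) f) (Set.Icc 0 (G.r c)) := by
  simp_rw [cost_eq]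
  exact (integ (hσ.2 c) (fun p => ∑ e ∈ p, G.lat e (f e)) _).sub
    ((integ_w (hσ.2 c) (fun p => ∑ e ∈ p, G.lat e 0) _ _ (hβ c).2.1 (hβ c).2.2).const_mul γ)

lemma cost_sum {β : G.C → ℝ → ℝ} (hβ : G.IsSensitivity β) (γ : ℝ)
    {σ : G.C → ℝ → Finset G.E} (hσ : G.IsAssignment σ) (f : G.E → ℝ) :
    ∑ c, ∫ x in Set.Icc 0 (G.r c), G.cost β γ c x (σ c x) f
      = ∑ e, G.lat e (f e) * G.edgeFlow σ e
        - γ * ∑ c, ∫ x in Set.Icc (0:ℝ) (G.r c), β c x * ∑ e ∈ σ c x, G.lat e 0 := by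
  rw [sum_flow hσ, Finset.mul_sum, ← Finset.sum_sub_distrib]
  refine Finset.sum_congr rfl fun c _ => ?_
  simp_rw [cost_eq]
  rw [integral_sub (integ (hσ.2 c) (fun p => ∑ e ∈ p, G.lat e (f e)) _)
    ((integ_w (hσ.2 c) (fun p => ∑ e ∈ p, G.lat e 0) _ _ (hβ c).2.1 (hβ c).2.2).const_mul γ),
    integral_const_mul]

lemma key {β : G.C → ℝ → ℝ} (hβ : G.IsSensitivity β) (γ : ℝ)
    {σ τ : G.C → ℝ → Finset G.E} (hσ : G.IsAssignment σ) (hτ : G.IsAssignment τ) :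
    ∑ c, ∫ x in Set.Icc 0 (G.r c), (G.cost β γ c x (τ c x) (G.edgeFlow σ)
        - G.cost β γ c x (σ c x) (G.edgeFlow σ))
      ≤ G.potential β γ τ - G.potential β γ σ := by
  have h1 : ∑ c, ∫ x in Set.Icc 0 (G.r c), (G.cost β γ c x (τ c x) (G.edgeFlow σ)
        - G.cost β γ c x (σ c x) (G.edgeFlow σ))
      = ∑ c, (∫ x in Set.Icc 0 (G.r c), G.cost β γ c x (τ c x) (G.edgeFlow σ))
        - ∑ c, ∫ x in Set.Icc 0 (G.r c), G.cost β γ c x (σ c x) (G.edgeFlow σ) := by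
    rw [← Finset.sum_sub_distrib]
    exact Finset.sum_congr rfl fun c _ =>
      integral_sub (cost_integ hβ γ hτ c _) (cost_integ hβ γ hσ c _)
  rw [h1, cost_sum hβ γ hτ, cost_sum hβ γ hσ]
  have h2 := Finset.sum_le_sum fun e (_ : e ∈ Finset.univ) =>
    tangent e (edgeFlow_nonneg σ e) (edgeFlow_nonneg τ e)
  simp only [mul_sub, Finset.sum_add_distrib, Finset.sum_sub_distrib] at h2
  unfold potential
  linarith

lemma nash_min {β : G.C → ℝ → ℝ} (hβ : G.IsSensitivity β) (γ : ℝ)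
    {σ τ : G.C → ℝ → Finset G.E} (hσ : G.IsNashFlow β γ σ) (hτ : G.IsAssignment τ) :
    G.potential β γ σ ≤ G.potential β γ τ := by
  have hk := key hβ γ hσ.1 hτ
  have : 0 ≤ ∑ c, ∫ x in Set.Icc 0 (G.r c), (G.cost β γ c x (τ c x) (G.edgeFlow σ)
        - G.cost β γ c x (σ c x) (G.edgeFlow σ)) := by
    refine Finset.sum_nonneg fun c _ => integral_nonneg_of_ae ?_
    filter_upwards [hσ.2 c, ae_restrict_mem measurableSet_Icc] with x hx hm
    exact sub_nonneg.2 (hx _ (hτ.1 c x hm))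
  linarith

lemma min_nash {β : G.C → ℝ → ℝ} (hβ : G.IsSensitivity β) (γ : ℝ)
    {σ : G.C → ℝ → Finset G.E} (hσ : G.IsAssignment σ)
    (hmin : ∀ τ, G.IsAssignment τ → G.potential β γ σ ≤ G.potential β γ τ) :
    G.IsNashFlow β γ σ := by
  classical
  refine ⟨hσ, fun c => ?_⟩
  suffices H : ∀ p ∈ G.paths c, ∀ ε : ℝ, 0 < ε → ∀ᵐ x ∂(volume.restrict (Set.Icc 0 (G.r c))),
      G.cost β γ c x (σ c x) (G.edgeFlow σ) ≤ G.cost β γ c x p (G.edgeFlow σ) + ε by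
    have H2 : ∀ p : Finset G.E, ∀ᵐ x ∂(volume.restrict (Set.Icc 0 (G.r c))), p ∈ G.paths c →
        G.cost β γ c x (σ c x) (G.edgeFlow σ) ≤ G.cost β γ c x p (G.edgeFlow σ) := by
      intro p
      by_cases hp : p ∈ G.paths c
      · have := ae_all_iff.2 fun n : ℕ => H p hp (1 / ((n:ℝ) + 1)) (by positivity)
        filter_upwards [this] with x hx _
        refine le_of_forall_pos_le_add fun ε hε => ?_
        obtain ⟨n, hn⟩ := exists_nat_one_div_lt hε
        linarith [hx n]
      · exact Filter.Eventually.of_forall fun x h => absurd h hp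
    exact ae_all_iff.2 H2
  intro p hp ε hε
  set f := G.edgeFlow σ with hf
  set η : ℝ := ε / (4 * ((Fintype.card G.E : ℝ) + 1)) with hη
  have hηpos : 0 < η := by positivity
  have hηc : (Fintype.card G.E : ℝ) * η ≤ ε / 4 := by
    rw [hη, ← mul_div_assoc, div_le_div_iff₀ (by positivity) (by positivity)]
    nlinarith
  have hδ : ∃ δ : ℝ, 0 < δ ∧ ∀ e, ∀ y, 0 ≤ y → |y - f e| ≤ δ →
      |G.lat e y - G.lat e (f e)| ≤ η := by
    have h1 : ∀ e, ∀ᶠ δ : ℝ in nhdsWithin 0 (Set.Ioi 0), ∀ y, 0 ≤ y → |y - f e| ≤ δ →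
        |G.lat e y - G.lat e (f e)| ≤ η := by
      intro e
      have hc := (G.lat_smooth e).continuousOn (f e) (edgeFlow_nonneg σ e)
      obtain ⟨d, hd, h⟩ := Metric.continuousWithinAt_iff.1 hc η hηpos
      filter_upwards [Ioo_mem_nhdsGT hd] with δ hδ y hy hyd
      exact (h hy (by rw [Real.dist_eq]; linarith [hδ.2])).le
    obtain ⟨δ, h, h'⟩ := ((Filter.eventually_all.2 h1).and self_mem_nhdsWithin).exists
    exact ⟨δ, h', h⟩
  obtain ⟨δ, hδ0, hδ⟩ := hδ
  set D : Set ℝ := {x | x ∈ Set.Icc 0 (G.r c) ∧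
    G.cost β γ c x p f + ε < G.cost β γ c x (σ c x) f} with hD
  have hcm : ∀ s : ℝ → Finset G.E, (∀ p, MeasurableSet {x | s x = p}) → 
      Measurable (fun x => G.cost β γ c x (s x) f) := by
    intro s hs
    simp_rw [cost_eq]
    exact (meas_comp hs (fun p => ∑ e ∈ p, G.lat e (f e))).sub
      (((hβ c).2.1.mul (meas_comp hs (fun p => ∑ e ∈ p, G.lat e 0))).const_mul γ)
  have hDm : MeasurableSet D := by
    have h1 : Measurable (fun x => G.cost β γ c x p f + ε) :=
      (hcm (fun _ => p) (fun q => by simp)).add_const ε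
    have h2 := measurableSet_lt h1 (hcm _ (hσ.2 c))
    exact measurableSet_Icc.inter h2
  have hDr : D ⊆ Set.Icc 0 (G.r c) := fun x hx => hx.1
  by_cases hD0 : volume D = 0
  · rw [ae_restrict_iff' measurableSet_Icc]
    filter_upwards [measure_eq_zero_iff_ae_notMem.1 hD0] with x hx hxr
    by_contra hcon
    exact hx ⟨hxr, not_le.1 hcon⟩
  exfalso
  have hDfin : volume D ≠ ⊤ := ne_top_of_le_ne_top (by simp) (measure_mono hDr)
  have hDpos : 0 < volume.real D := ENNReal.toReal_pos hD0 hDfin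
  obtain ⟨t, ht, hv⟩ := exists_cut (G.r c) (G.r_pos c).le D hDm hDr (min δ (volume.real D))
    (by positivity) (min_le_right _ _)
  set D' := D ∩ Set.Iic t with hD'
  have hD'm : MeasurableSet D' := hDm.inter measurableSet_Iic
  have hD'r : D' ⊆ Set.Icc 0 (G.r c) := Set.inter_subset_left.trans hDr
  have hv0 : 0 < volume.real D' := by rw [hv]; positivity
  have hvδ : volume.real D' ≤ δ := by rw [hv]; exact min_le_left _ _
  set τ : G.C → ℝ → Finset G.E := fun c' x => if c' = c ∧ x ∈ D' then p else σ c' x with hτdef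
  have hτ1 : ∀ c', c' ≠ c → τ c' = σ c' := by
    intro c' h; ext1 x; simp [hτdef, h]
  have hτ2 : ∀ x, x ∈ D' → τ c x = p := by
    intro x h; simp [hτdef, h]
  have hτ3 : ∀ x, x ∉ D' → τ c x = σ c x := by
    intro x h; simp [hτdef, h]
  have hτ : G.IsAssignment τ := by
    constructor
    · intro c' x hx
      by_cases h : c' = c ∧ x ∈ D'
      · simp only [hτdef, if_pos h]; rw [h.1]; exact hp
      · simp only [hτdef, if_neg h]; exact hσ.1 c' x hx
    · intro c' q
      by_cases h : c' = c
      · subst h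
        have : {x | τ c' x = q} = (D' ∩ {x | p = q}) ∪ (D'ᶜ ∩ {x | σ c' x = q}) := by
          ext x
          by_cases hx : x ∈ D'
          · simp [hτ2 x hx, hx]
          · simp [hτ3 x hx, hx]
        rw [this]
        exact (hD'm.inter (MeasurableSet.const _)).union (hD'm.compl.inter (hσ.2 c' q))
      · rw [hτ1 c' h]; exact hσ.2 c' q
  set g := G.edgeFlow τ with hg
  have hindD : ∀ k : ℝ, ∫ x in Set.Icc 0 (G.r c), D'.indicator (fun _ => k) x
      = k * volume.real D' := by
    intro k
    rw [integral_indicator_const _ hD'm, measureReal_restrict_apply hD'm,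
      Set.inter_eq_left.2 hD'r, smul_eq_mul, mul_comm]
  have hindI : ∀ k : ℝ, IntegrableOn (D'.indicator (fun _ => k)) (Set.Icc 0 (G.r c)) := by
    intro k
    exact (integrableOn_const (by simp)).indicator hD'm
  have hgf : ∀ e, |g e - f e| ≤ δ := by
    intro e
    refine le_trans ?_ hvδ
    rw [hg, hf, edgeFlow_eq hτ, edgeFlow_eq hσ, ← Finset.sum_sub_distrib,
      Finset.sum_eq_single c]
    · have iτ := integ (hτ.2 c) (fun p => if e ∈ p then (1:ℝ) else 0) (G.r c)
      have iσ := integ (hσ.2 c) (fun p => if e ∈ p then (1:ℝ) else 0) (G.r c)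
      rw [← integral_sub iτ iσ]
      have := hindD 1
      rw [one_mul] at this
      rw [← this, ← Real.norm_eq_abs]
      refine norm_integral_le_of_norm_le (hindI 1) (Filter.Eventually.of_forall fun x => ?_)
      by_cases hx : x ∈ D'
      · rw [Set.indicator_of_mem hx, Real.norm_eq_abs]
        split_ifs <;> simp
      · rw [Set.indicator_of_notMem hx, hτ3 x hx]; simp
    · intro c' _ h
      rw [hτ1 c' h, sub_self]
    · simp
  have hA : ∀ q : Finset G.E, |∑ e ∈ q, G.lat e (g e) - ∑ e ∈ q, G.lat e (f e)| ≤ ε / 4 := by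
    intro q
    rw [← Finset.sum_sub_distrib]
    refine (Finset.abs_sum_le_sum_abs _ _).trans ?_
    refine (Finset.sum_le_sum fun e _ => hδ e (g e) (edgeFlow_nonneg τ e) (hgf e)).trans ?_
    rw [Finset.sum_const, nsmul_eq_mul]
    refine le_trans ?_ hηc
    gcongr
    exact Finset.card_le_univ q
  have hk := key hβ γ hτ hσ
  have hm := hmin τ hτ
  have hpos : ε / 2 * volume.real D' ≤ ∑ c', ∫ x in Set.Icc 0 (G.r c'),
      (G.cost β γ c' x (σ c' x) g - G.cost β γ c' x (τ c' x) g) := by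
    rw [Finset.sum_eq_single c]
    · rw [← hindD]
      refine setIntegral_mono_on (hindI _)
        ((cost_integ hβ γ hσ c g).sub (cost_integ hβ γ hτ c g)) measurableSet_Icc fun x _ => ?_
      by_cases hx : x ∈ D'
      · rw [Set.indicator_of_mem hx, hτ2 x hx]
        have h1 := hx.1.2
        have h2 := abs_le.1 (hA p)
        have h3 := abs_le.1 (hA (σ c x))
        rw [cost_eq, cost_eq] at h1 ⊢
        linarith [h2.1, h2.2, h3.1, h3.2]
      · rw [Set.indicator_of_notMem hx, hτ3 x hx, sub_self]
    · intro c' _ h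
      rw [hτ1 c' h]; simp
    · simp
  have : 0 < ε / 2 * volume.real D' := by positivity
  linarith

lemma mix_le {s s' : ℝ → Finset G.E} (hs : ∀ p, MeasurableSet {x | s x = p})
    (hs' : ∀ p, MeasurableSet {x | s' x = p}) (r lam : ℝ)
    (A : Finset G.E → Finset G.E → Set ℝ) (hA : ∀ p q, MeasurableSet (A p q))
    (s'' : ℝ → Finset G.E) (hs'' : ∀ p, MeasurableSet {x | s'' x = p})
    (hin : ∀ x, x ∈ A (s x) (s' x) → s'' x = s x)
    (hout : ∀ x, x ∉ A (s x) (s' x) → s'' x = s' x)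
    (w : ℝ → ℝ) (hw : Measurable w) (hwb : ∀ x ∈ Set.Icc 0 r, w x ∈ Set.Icc (0:ℝ) 1)
    (h : Finset G.E → ℝ)
    (hle : ∀ p q, 
      lam * (h p * ∫ x in Set.Icc 0 r ∩ {x | s x = p ∧ s' x = q}, w x)
        + (1 - lam) * (h q * ∫ x in Set.Icc 0 r ∩ {x | s x = p ∧ s' x = q}, w x)
      ≤ h p * (∫ x in (Set.Icc 0 r ∩ {x | s x = p ∧ s' x = q}) ∩ A p q, w x)
        + h q * ∫ x in (Set.Icc 0 r ∩ {x | s x = p ∧ s' x = q}) \ A p q, w x) :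
    lam * (∫ x in Set.Icc 0 r, w x * h (s x)) + (1 - lam) * (∫ x in Set.Icc 0 r, w x * h (s' x))
      ≤ ∫ x in Set.Icc 0 r, w x * h (s'' x) := by
  set S : Finset G.E × Finset G.E → Set ℝ :=
    fun pq => Set.Icc 0 r ∩ {x | s x = pq.1 ∧ s' x = pq.2} with hSdef
  have hSm : ∀ pq, MeasurableSet (S pq) := fun pq =>
    measurableSet_Icc.inter ((hs pq.1).inter (hs' pq.2))
  have hU : Set.Icc 0 r = ⋃ pq, S pq := by
    ext x
    simp only [hSdef, Set.mem_iUnion]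
    constructor
    · intro hx; exact ⟨(s x, s' x), hx, rfl, rfl⟩
    · rintro ⟨_, hx, _⟩; exact hx
  have hdisj : Pairwise (Function.onFun Disjoint S) := by
    intro a b hab
    refine Set.disjoint_left.2 fun x hx hy => hab ?_
    exact Prod.ext (hx.2.1.symm.trans hy.2.1) (hx.2.2.symm.trans hy.2.2)
  have hSsub : ∀ pq, S pq ⊆ Set.Icc 0 r := fun pq => Set.inter_subset_left
  have hsplit : ∀ F : ℝ → ℝ, IntegrableOn F (Set.Icc 0 r) →
      ∫ x in Set.Icc 0 r, F x = ∑ pq, ∫ x in S pq, F x := by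
    intro F hF
    conv_lhs => rw [hU]
    exact integral_iUnion_fintype hSm hdisj (fun pq => hF.mono_set (hSsub pq))
  have i1 := integ_w hs h r w hw hwb
  have i2 := integ_w hs' h r w hw hwb
  have i3 := integ_w hs'' h r w hw hwb
  rw [hsplit _ i1, hsplit _ i2, hsplit _ i3, Finset.mul_sum, Finset.mul_sum,
    ← Finset.sum_add_distrib]
  refine Finset.sum_le_sum fun pq _ => ?_
  have e1 : ∫ x in S pq, w x * h (s x) = h pq.1 * ∫ x in S pq, w x := by
    rw [← integral_const_mul]
    refine setIntegral_congr_fun (hSm pq) fun x hx => ?_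
    simp only [hx.2.1]; ring
  have e2 : ∫ x in S pq, w x * h (s' x) = h pq.2 * ∫ x in S pq, w x := by
    rw [← integral_const_mul]
    refine setIntegral_congr_fun (hSm pq) fun x hx => ?_
    simp only [hx.2.2]; ring
  have e3 : ∫ x in S pq ∩ A pq.1 pq.2, w x * h (s'' x)
      = h pq.1 * ∫ x in S pq ∩ A pq.1 pq.2, w x := by
    rw [← integral_const_mul]
    refine setIntegral_congr_fun ((hSm pq).inter (hA _ _)) fun x hx => ?_
    have : s'' x = s x := hin x (by rw [hx.1.2.1, hx.1.2.2]; exact hx.2)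
    simp only [this, hx.1.2.1]; ring
  have e4 : ∫ x in S pq \ A pq.1 pq.2, w x * h (s'' x)
      = h pq.2 * ∫ x in S pq \ A pq.1 pq.2, w x := by
    rw [← integral_const_mul]
    refine setIntegral_congr_fun ((hSm pq).diff (hA _ _)) fun x hx => ?_
    have : s'' x = s' x := hout x (by rw [hx.1.2.1, hx.1.2.2]; exact hx.2)
    simp only [this, hx.1.2.2]; ring
  rw [e1, e2, ← integral_inter_add_sdiff (hA pq.1 pq.2) (i3.mono_set (hSsub pq)), e3, e4]
  exact hle pq.1 pq.2

lemma mix {β : G.C → ℝ → ℝ} (hβ : G.IsSensitivity β)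
    {σ σ' : G.C → ℝ → Finset G.E} (hσ : G.IsAssignment σ) (hσ' : G.IsAssignment σ')
    (lam : ℝ) (hl : lam ∈ Set.Icc (0:ℝ) 1) (L : Finset G.E → ℝ) :
    ∃ τ : G.C → ℝ → Finset G.E, G.IsAssignment τ ∧
      (∀ c (h : Finset G.E → ℝ), ∫ x in Set.Icc 0 (G.r c), h (τ c x)
        = lam * (∫ x in Set.Icc 0 (G.r c), h (σ c x))
          + (1 - lam) * (∫ x in Set.Icc 0 (G.r c), h (σ' c x))) ∧
      (∀ c, lam * (∫ x in Set.Icc 0 (G.r c), β c x * L (σ c x))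
          + (1 - lam) * (∫ x in Set.Icc 0 (G.r c), β c x * L (σ' c x))
        ≤ ∫ x in Set.Icc 0 (G.r c), β c x * L (τ c x)) := by
  classical
  have hSm : ∀ c p q, MeasurableSet (Set.Icc 0 (G.r c) ∩ {x | σ c x = p ∧ σ' c x = q}) :=
    fun c p q => measurableSet_Icc.inter ((hσ.2 c p).inter (hσ'.2 c q))
  have hβi : ∀ c, IntegrableOn (β c) (Set.Icc 0 (G.r c)) := fun c => by
    simpa using integ_w (hσ.2 c) (fun _ => 1) (G.r c) (β c) (hβ c).2.1 (hβ c).2.2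
  have hex := fun c p q => cell (G.r c) (G.r_pos c).le (β c) (hβ c).1 (hβi c) _ (hSm c p q)
    Set.inter_subset_left lam hl.1 hl.2 (L p) (L q)
  choose A hAm hAv hAi using hex
  set τ : G.C → ℝ → Finset G.E :=
    fun c x => if x ∈ A c (σ c x) (σ' c x) then σ c x else σ' c x with hτdef
  have hin : ∀ c x, x ∈ A c (σ c x) (σ' c x) → τ c x = σ c x := fun c x h => by simp [hτdef, h]
  have hout : ∀ c x, x ∉ A c (σ c x) (σ' c x) → τ c x = σ' c x := fun c x h => by
    simp [hτdef, h]
  have hτ : G.IsAssignment τ := by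
    constructor
    · intro c x hx
      by_cases h : x ∈ A c (σ c x) (σ' c x)
      · rw [hin c x h]; exact hσ.1 c x hx
      · rw [hout c x h]; exact hσ'.1 c x hx
    · intro c q
      have hT : MeasurableSet {x | x ∈ A c (σ c x) (σ' c x)} := by
        have : {x | x ∈ A c (σ c x) (σ' c x)}
            = ⋃ p, ⋃ p', ({x | σ c x = p} ∩ {x | σ' c x = p'}) ∩ A c p p' := by
          ext x; simp
        rw [this]
        exact MeasurableSet.iUnion fun p => MeasurableSet.iUnion fun p' =>
          ((hσ.2 c p).inter (hσ'.2 c p')).inter (hAm c p p')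
      have : {x | τ c x = q} = ({x | x ∈ A c (σ c x) (σ' c x)} ∩ {x | σ c x = q})
          ∪ ({x | x ∈ A c (σ c x) (σ' c x)}ᶜ ∩ {x | σ' c x = q}) := by
        ext x
        by_cases h : x ∈ A c (σ c x) (σ' c x)
        · simp [hin c x h, h]
        · simp [hout c x h, h]
      rw [this]
      exact (hT.inter (hσ.2 c q)).union (hT.compl.inter (hσ'.2 c q))
  have hone : ∀ c (h : Finset G.E → ℝ), lam * (∫ x in Set.Icc 0 (G.r c), h (σ c x))
          + (1 - lam) * (∫ x in Set.Icc 0 (G.r c), h (σ' c x))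
        ≤ ∫ x in Set.Icc 0 (G.r c), h (τ c x) := by
    intro c h
    have := mix_le (hσ.2 c) (hσ'.2 c) (G.r c) lam (A c) (hAm c) (τ c) (hτ.2 c) (hin c) (hout c)
      (fun _ => 1) measurable_const (by simp) h (by
        intro p q
        have hfin : volume (Set.Icc 0 (G.r c) ∩ {x | σ c x = p ∧ σ' c x = q}) ≠ ⊤ :=
          ne_top_of_le_ne_top (by simp) (measure_mono Set.inter_subset_left)
        have hvs := measureReal_inter_add_sdiff (μ := volume) (hAm c p q) hfin
        have hv := hAv c p q
        rw [hv] at hvs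
        have hv2 : volume.real ((Set.Icc 0 (G.r c) ∩ {x | σ c x = p ∧ σ' c x = q}) \ A c p q)
          = (1 - lam) * volume.real (Set.Icc 0 (G.r c) ∩ {x | σ c x = p ∧ σ' c x = q}) := by
          linarith
        simp only [setIntegral_const, smul_eq_mul, mul_one]
        rw [hv, hv2]
        apply le_of_eq; ring)
    simpa using this
  refine ⟨τ, hτ, fun c h => le_antisymm ?_ (hone c h), fun c => ?_⟩
  · have := hone c (fun p => - h p)
    simp only [integral_neg] at this
    linarith
  · exact mix_le (hσ.2 c) (hσ'.2 c) (G.r c) lam (A c) (hAm c) (τ c) (hτ.2 c) (hin c) (hout c)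
      (β c) (hβ c).2.1 (hβ c).2.2 L (hAi c)

end RoutingProblem

/-- Lemma 2, convex potential characterization: the potential
`Φ(σ) = Σ_e ∫_0^{f_e} ℓ_e − γ Σ_c ∫ β^c(x)·Σ_{e∈σ^c(x)} ℓ_e(0) dx` is convex
(along mixtures of assignments at the path-flow level), and `σ` is a Nash flow
of `(G, β, γ)` iff it minimizes `Φ` over all assignments. -/
theorem nash_iff_potential_min (G : RoutingProblem) (β : G.C → ℝ → ℝ)
    (hβ : G.IsSensitivity β) (γ : ℝ) (hγ : 0 ≤ γ) :
    (∀ σ σ' : G.C → ℝ → Finset G.E, G.IsAssignment σ → G.IsAssignment σ' →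
      ∀ lam ∈ Set.Icc (0:ℝ) 1,
        ∃ σ'' : G.C → ℝ → Finset G.E, G.IsAssignment σ'' ∧
          (∀ p : Finset G.E, G.pathFlow σ'' p
              = lam * G.pathFlow σ p + (1 - lam) * G.pathFlow σ' p) ∧
          G.potential β γ σ''
            ≤ lam * G.potential β γ σ + (1 - lam) * G.potential β γ σ') ∧
    ∀ σ : G.C → ℝ → Finset G.E,
      G.IsNashFlow β γ σ ↔
        (G.IsAssignment σ ∧ ∀ σ' : G.C → ℝ → Finset G.E, G.IsAssignment σ' →
          G.potential β γ σ ≤ G.potential β γ σ') := by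
  refine ⟨?_, fun σ => ⟨fun h => ⟨h.1, fun τ hτ => RoutingProblem.nash_min hβ γ h hτ⟩,
    fun h => RoutingProblem.min_nash hβ γ h.1 h.2⟩⟩
  intro σ σ' hσ hσ' lam hl
  obtain ⟨τ, hτ, hlin, hB⟩ := RoutingProblem.mix hβ hσ hσ' lam hl (fun p => ∑ e ∈ p, G.lat e 0)
  have hedge : ∀ e, G.edgeFlow τ e = lam * G.edgeFlow σ e + (1 - lam) * G.edgeFlow σ' e := by
    intro e
    rw [RoutingProblem.edgeFlow_eq hτ, RoutingProblem.edgeFlow_eq hσ,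
      RoutingProblem.edgeFlow_eq hσ', Finset.mul_sum, Finset.mul_sum, ← Finset.sum_add_distrib]
    exact Finset.sum_congr rfl fun c _ => hlin c (fun p => if e ∈ p then 1 else 0)
  refine ⟨τ, hτ, ?_, ?_⟩
  · intro p
    rw [RoutingProblem.pathFlow_eq hτ, RoutingProblem.pathFlow_eq hσ,
      RoutingProblem.pathFlow_eq hσ', Finset.mul_sum, Finset.mul_sum, ← Finset.sum_add_distrib]
    exact Finset.sum_congr rfl fun c _ => hlin c (fun q => if q = p then 1 else 0)
  · have hconv : ∑ e, ∫ t in (0:ℝ)..(G.edgeFlow τ e), G.lat e t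
        ≤ lam * (∑ e, ∫ t in (0:ℝ)..(G.edgeFlow σ e), G.lat e t)
          + (1 - lam) * (∑ e, ∫ t in (0:ℝ)..(G.edgeFlow σ' e), G.lat e t) := by
      rw [Finset.mul_sum, Finset.mul_sum, ← Finset.sum_add_distrib]
      refine Finset.sum_le_sum fun e _ => ?_
      have t1 := mul_le_mul_of_nonneg_left (RoutingProblem.tangent e
        (RoutingProblem.edgeFlow_nonneg τ e) (RoutingProblem.edgeFlow_nonneg σ e)) hl.1
      have t2 := mul_le_mul_of_nonneg_left (RoutingProblem.tangent e
        (RoutingProblem.edgeFlow_nonneg τ e) (RoutingProblem.edgeFlow_nonneg σ' e))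
        (sub_nonneg.2 hl.2)
      have t3 : G.lat e (G.edgeFlow τ e) * (lam * G.edgeFlow σ e + (1 - lam) * G.edgeFlow σ' e
        - G.edgeFlow τ e) = 0 := by rw [← hedge e]; ring
      linarith
    have hBs := Finset.sum_le_sum fun c (_ : c ∈ Finset.univ) => hB c
    rw [Finset.sum_add_distrib, ← Finset.mul_sum, ← Finset.mul_sum] at hBs
    have hBg := mul_le_mul_of_nonneg_left hBs hγ
    unfold RoutingProblem.potential
    linarith
end

section
/- (Theorem 3, part 1: equilibrium equivalence.) Fix an integer d ≥ 1 and a routing problem G whose latency functions have the form ℓ_e(y) = a_e·y^d + b_e with constants a_e, b_e ≥ 0. For each commodity c let α^c : [0, r^c] → [0, 1] be measurable (the users' altruism parameters), and consider the heterogeneous altruism game in which user x of commodity c evaluates path p under flow f by the cost J_alt^{c,x}(p; f) = Σ_{e∈p} [(1 + d·α^c(x))·a_e·(f_e)^d + b_e]. Define β^c(x) := α^c(x)·d / (α^c(x)·d + 1). Then the set of Nash flows of the altruism game equals the set of Nash flows of the slowdown-sensitivity game (G, β, 1). -/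
open MeasureTheory

/-- Theorem 3, part 1: the heterogeneous altruism game with
costs `Σ_{e∈p} ((1 + d α^c(x)) a_e (f_e)^d + b_e)` has the same Nash flows as
the slowdown-sensitivity game `(G, β, 1)` with
`β^c(x) = α^c(x) d / (α^c(x) d + 1)`. -/
theorem altruism_nash_equivalence (d : ℕ) (hd : 1 ≤ d) (G : RoutingProblem)
    (a b : G.E → ℝ) (ha : ∀ e, 0 ≤ a e) (hb : ∀ e, 0 ≤ b e)
    (hlat : ∀ e y, G.lat e y = a e * y ^ d + b e)
    (α : G.C → ℝ → ℝ) (hαmeas : ∀ c, Measurable (α c))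
    (hα01 : ∀ c x, α c x ∈ Set.Icc (0:ℝ) 1)
    (β : G.C → ℝ → ℝ)
    (hβ : ∀ c x, β c x = α c x * (d : ℝ) / (α c x * (d : ℝ) + 1))
    (σ : G.C → ℝ → Finset G.E) :
    G.IsNashFor
        (fun c x p f => ∑ e ∈ p, ((1 + (d : ℝ) * α c x) * a e * f e ^ d + b e))
        σ ↔
      G.IsNashFlow β 1 σ := by
  have hpos : ∀ c x, 0 < 1 + (d : ℝ) * α c x := fun c x => by
    have := (hα01 c x).1
    positivity
  have key : ∀ c x p (f : G.E → ℝ),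
      ∑ e ∈ p, ((1 + (d : ℝ) * α c x) * a e * f e ^ d + b e)
        = (1 + (d : ℝ) * α c x) * G.cost β 1 c x p f := by
    intro c x p f
    unfold RoutingProblem.cost
    rw [Finset.mul_sum]
    refine Finset.sum_congr rfl fun e _ => ?_
    have h := hpos c x
    have h' : α c x * (d : ℝ) + 1 ≠ 0 := by
      have : α c x * (d : ℝ) + 1 = 1 + (d : ℝ) * α c x := by ring
      rw [this]
      exact h.ne'
    have h0 : (0 : ℝ) ^ d = 0 := zero_pow (by omega)
    rw [hlat, hlat, hβ, h0]
    have h2 : (1 + (d : ℝ) * α c x) * (α c x * (d : ℝ) / (α c x * (d : ℝ) + 1))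
        = α c x * (d : ℝ) := by
      rw [show 1 + (d : ℝ) * α c x = α c x * (d : ℝ) + 1 by ring]
      exact mul_div_cancel₀ _ h'
    linear_combination (b e) * h2
  unfold RoutingProblem.IsNashFlow RoutingProblem.IsNashFor
  simp only [key, mul_le_mul_iff_right₀ (hpos _ _)]
end
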